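/- arXiv:1405.6381 — 3 statements merged into one kernel-verified Lean document; each statement's English description precedes it below -/
import Mathlib

section
/- Let F be an algebraic closure of a finite field, let X⁰ be a scheme of finite type over F, and let f : X⁰ → X⁰ be a dominant morphism. Then the set of f-periodic points is Zariski dense in X⁰. -/
/-!
Corollary 1.4 of Varshavsky, "Intersection of a correspondence with a graph of Frobenius"
(see also Fakhruddin, Prop 5.5): for a dominant endomorphism `f` of a scheme `X⁰` of finite
type over an algebraic closure `F` of a finite field, the set of `f`-periodic points
(`F`-points `x` with `f^m(x) = x` for some `m ≥ 1`) is Zariski dense.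
-/

open AlgebraicGeometry CategoryTheory CategoryTheory.Limits TopologicalSpace Opposite

universe u

/-- The `n`-th iterate of an endomorphism of a scheme. -/
def iterateHom {X : Scheme.{u}} (f : X ⟶ X) : ℕ → (X ⟶ X)
  | 0 => 𝟙 X
  | n + 1 => f ≫ iterateHom f n

set_option linter.style.haveILetI false

namespace PPD

section Filt
variable {k C : Type*} [Field k] [CommRing C] [Algebra k C] {n : ℕ} (a : Fin n → C)

/-- span of monomials of degree at most `N`. -/
def V (k : Type*) {C : Type*} [Field k] [CommRing C] [Algebra k C] {n : ℕ} (a : Fin n → C)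
    (N : ℕ) : Submodule k C :=
  Submodule.span k {x | ∃ s : Fin n → ℕ, ∑ i, s i ≤ N ∧ x = ∏ i, a i ^ s i}

lemma mon_mem (s : Fin n → ℕ) {N : ℕ} (h : ∑ i, s i ≤ N) : ∏ i, a i ^ s i ∈ V k a N :=
  Submodule.subset_span ⟨s, h, rfl⟩

lemma V_mono {N M : ℕ} (h : N ≤ M) : V k a N ≤ V k a M := by
  apply Submodule.span_mono
  rintro x ⟨s, hs, rfl⟩
  exact ⟨s, hs.trans h, rfl⟩

lemma one_mem_V (N : ℕ) : (1 : C) ∈ V k a N := by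
  have := mon_mem (k := k) a (fun _ => 0) (N := N) (by simp)
  simpa using this

lemma gen_mem_V (i : Fin n) : a i ∈ V k a 1 := by
  classical
  have := mon_mem (k := k) a (Pi.single i 1) (N := 1) (by simp)
  rw [Finset.prod_eq_single i] at this
  · simpa using this
  · intro j _ hj; simp [hj]
  · simp

lemma V_mul {N M : ℕ} {x y : C} (hx : x ∈ V k a N) (hy : y ∈ V k a M) :
    x * y ∈ V k a (N + M) := by
  have h : V k a N * V k a M ≤ V k a (N + M) := by
    unfold V
    rw [Submodule.span_mul_span, Submodule.span_le]
    rintro _ ⟨_, ⟨s, hs, rfl⟩, _, ⟨t, ht, rfl⟩, rfl⟩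
    refine Submodule.subset_span ⟨s + t, ?_, ?_⟩
    · simp only [Pi.add_apply, Finset.sum_add_distrib]; omega
    · simp [pow_add, Finset.prod_mul_distrib]
  exact h (Submodule.mul_mem_mul hx hy)

lemma V_pow {N : ℕ} {x : C} (hx : x ∈ V k a N) (m : ℕ) : x ^ m ∈ V k a (N * m) := by
  induction m with
  | zero => simpa using one_mem_V a 0
  | succ m ih => rw [pow_succ, Nat.mul_succ]; exact V_mul a ih hx

instance V_finite (N : ℕ) : Module.Finite k (V k a N) := by
  rw [Module.Finite.iff_fg]
  apply Submodule.fg_span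
  have : {x : C | ∃ s : Fin n → ℕ, ∑ i, s i ≤ N ∧ x = ∏ i, a i ^ s i} ⊆
      Set.range (fun s : Fin n → Fin (N + 1) => ∏ i, a i ^ (s i : ℕ)) := by
    rintro x ⟨s, hs, rfl⟩
    refine ⟨fun i => ⟨s i, ?_⟩, rfl⟩
    have := Finset.single_le_sum (f := s) (fun _ _ => Nat.zero_le _) (Finset.mem_univ i)
    omega
  exact (Set.finite_range _).subset this

lemma exists_mem_V (ha : Algebra.adjoin k (Set.range a) = ⊤) (x : C) : ∃ N, x ∈ V k a N := by
  have hx : x ∈ Algebra.adjoin k (Set.range a) := by rw [ha]; trivial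
  induction hx using Algebra.adjoin_induction with
  | mem x hx => obtain ⟨i, rfl⟩ := hx; exact ⟨1, gen_mem_V a i⟩
  | algebraMap r =>
    refine ⟨0, ?_⟩
    rw [Algebra.algebraMap_eq_smul_one]
    exact Submodule.smul_mem _ _ (one_mem_V a 0)
  | add x y _ _ hx hy =>
    obtain ⟨N, hN⟩ := hx
    obtain ⟨M, hM⟩ := hy
    exact ⟨max N M, add_mem (V_mono a (le_max_left _ _) hN) (V_mono a (le_max_right _ _) hM)⟩
  | mul x y _ _ hx hy =>
    obtain ⟨N, hN⟩ := hx
    obtain ⟨M, hM⟩ := hy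
    exact ⟨N + M, V_mul a hN hM⟩

lemma exists_mem_V_fin (ha : Algebra.adjoin k (Set.range a) = ⊤) {ι : Type*} [Finite ι]
    (x : ι → C) : ∃ N, ∀ i, x i ∈ V k a N := by
  cases nonempty_fintype ι
  choose N hN using fun i => exists_mem_V (k := k) a ha (x i)
  exact ⟨∑ i, N i, fun i => V_mono a
    (Finset.single_le_sum (fun _ _ => Nat.zero_le _) (Finset.mem_univ i)) (hN i)⟩

/-- A ring hom sends `V N` to `V (δ N)`. -/
lemma map_V (φ : C →ₐ[k] C) {δ : ℕ} (hδ : ∀ i, φ (a i) ∈ V k a δ) {N : ℕ} {x : C}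
    (hx : x ∈ V k a N) : φ x ∈ V k a (δ * N) := by
  have key : ∀ (t : Finset (Fin n)) (s : Fin n → ℕ),
      ∏ i ∈ t, φ (a i) ^ s i ∈ V k a (δ * ∑ i ∈ t, s i) := by
    classical
    intro t s
    induction t using Finset.induction_on with
    | empty => simpa using one_mem_V a 0
    | insert i t hi ih =>
      rw [Finset.prod_insert hi, Finset.sum_insert hi, Nat.mul_add]
      exact V_mul a (V_pow a (hδ i) _) ih
  have : V k a N ≤ (V k a (δ * N)).comap φ.toLinearMap := by
    unfold V
    rw [Submodule.span_le]
    rintro _ ⟨s, hs, rfl⟩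
    have := key Finset.univ s
    simp only [Submodule.comap_coe, Set.mem_preimage, AlgHom.toLinearMap_apply, map_prod, map_pow,
      SetLike.mem_coe]
    exact V_mono a (Nat.mul_le_mul_left _ hs) this
  exact this hx

/-- a `Q⁻¹`-linear map. -/
def IsK (Q : ℕ) (κ : C →ₗ[k] C) : Prop := ∀ x y, κ (x ^ Q * y) = x * κ y

lemma IsK.bound (ha : Algebra.adjoin k (Set.range a) = ⊤) {Q : ℕ} (hQ : 0 < Q) {κ : C →ₗ[k] C}
    (hκ : IsK Q κ) : ∃ c, ∀ N, ∀ x ∈ V k a N, κ x ∈ V k a (N / Q + c) := by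
  obtain ⟨c, hc⟩ := exists_mem_V_fin (k := k) a ha
    (fun s : Fin n → Fin Q => κ (∏ i, a i ^ (s i : ℕ)))
  refine ⟨c, fun N => ?_⟩
  have : V k a N ≤ (V k a (N / Q + c)).comap κ := by
    unfold V
    rw [Submodule.span_le]
    rintro _ ⟨s, hs, rfl⟩
    have e : ∏ i, a i ^ s i = (∏ i, a i ^ (s i / Q)) ^ Q * ∏ i, a i ^ (s i % Q) := by
      rw [← Finset.prod_pow, ← Finset.prod_mul_distrib]
      refine Finset.prod_congr rfl fun i _ => ?_
      rw [← pow_mul, ← pow_add, Nat.div_add_mod']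
    simp only [Submodule.comap_coe, Set.mem_preimage, SetLike.mem_coe]
    rw [e, hκ]
    refine V_mul a (mon_mem a _ ?_) (hc fun i => ⟨s i % Q, Nat.mod_lt _ hQ⟩)
    rw [Nat.le_div_iff_mul_le hQ, Finset.sum_mul]
    exact (Finset.sum_le_sum fun i _ => Nat.div_mul_le_self _ _).trans hs
  exact this

/-- every element is a combination of small monomials with `Q`-th power coefficients -/
lemma small_span (ha : Algebra.adjoin k (Set.range a) = ⊤) {Q : ℕ} (hQ : 0 < Q) {κ : C →ₗ[k] C}
    (hκ : IsK Q κ) (h : C) (H : ∀ s : Fin n → Fin Q, κ ((∏ i, a i ^ (s i : ℕ)) * h) = 0) (x : C) :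
    κ (x * h) = 0 := by
  obtain ⟨N, hN⟩ := exists_mem_V (k := k) a ha x
  induction hN using Submodule.span_induction with
  | mem x hx =>
    obtain ⟨s, hs, rfl⟩ := hx
    have e : ∏ i, a i ^ s i = (∏ i, a i ^ (s i / Q)) ^ Q * ∏ i, a i ^ (s i % Q) := by
      rw [← Finset.prod_pow, ← Finset.prod_mul_distrib]
      refine Finset.prod_congr rfl fun i _ => ?_
      rw [← pow_mul, ← pow_add, Nat.div_add_mod']
    rw [e, mul_assoc, hκ, H fun i => ⟨s i % Q, Nat.mod_lt _ hQ⟩, mul_zero]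
  | zero => simp
  | add x y _ _ hx hy => rw [add_mul, map_add, hx, hy, add_zero]
  | smul c x _ hx => rw [smul_mul_assoc, map_smul, hx, smul_zero]

lemma IsK.comp {Q Q' : ℕ} {κ κ' : C →ₗ[k] C} (h : IsK Q κ) (h' : IsK Q' κ') :
    IsK (Q * Q') (κ' ∘ₗ κ) := by
  intro x y
  simp only [LinearMap.comp_apply]
  rw [mul_comm Q Q', pow_mul, h, h']

lemma IsK.iter {q : ℕ} {κ : C →ₗ[k] C} (h : IsK q κ) (e : ℕ) : IsK (q ^ e) (κ ^ e) := by
  induction e with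
  | zero => intro x y; simp
  | succ e ih => rw [pow_succ, pow_succ']; exact ih.comp h

lemma IsK.mulR {Q : ℕ} {κ : C →ₗ[k] C} (h : IsK Q κ) (u : C) :
    IsK Q (κ ∘ₗ LinearMap.mulLeft k u) := by
  intro x y
  simp only [LinearMap.comp_apply, LinearMap.mulLeft_apply]
  rw [← h]; congr 1; ring

lemma iter_bound {q : ℕ} (hq : 2 ≤ q) {κ : C →ₗ[k] C} {c : ℕ}
    (hc : ∀ N, ∀ x ∈ V k a N, κ x ∈ V k a (N / q + c)) (e : ℕ) :
    ∀ N, ∀ x ∈ V k a N, (κ ^ e) x ∈ V k a (N / q ^ e + (2 * c + 2)) := by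
  induction e with
  | zero => intro N x hx; exact V_mono a (by simp) hx
  | succ e ih =>
    intro N x hx
    rw [pow_succ' κ, Module.End.mul_apply]
    refine V_mono a ?_ (hc _ _ (ih N x hx))
    rw [pow_succ, ← Nat.div_div_eq_div_mul]
    generalize N / q ^ e = y
    have h1 : (y + (2 * c + 2)) / q ≤ y / q + (c + 2) := by
      have h2 : y < q * (y / q + 1) := Nat.lt_mul_div_succ _ (by omega)
      have h3 : 2 * (c + 1) ≤ q * (c + 1) := Nat.mul_le_mul_right _ hq
      have : (y + (2 * c + 2)) / q < y / q + (c + 2) := by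
        rw [Nat.div_lt_iff_lt_mul (by omega)]
        nlinarith
      omega
    omega

lemma iter_ne {C : Type*} [CommRing C] [IsDomain C] [Algebra k C] {q : ℕ} (hq : 1 ≤ q)
    {κ : C →ₗ[k] C} (h : IsK q κ) (h1 : κ 1 ≠ 0) (e : ℕ) :
    ∀ x : C, x ≠ 0 → ∃ u, (κ ^ e) (u * x) ≠ 0 := by
  induction e with
  | zero => intro x hx; exact ⟨1, by simpa using hx⟩
  | succ e ih =>
    intro x hx
    obtain ⟨y, hy⟩ := ih (x * κ 1) (mul_ne_zero hx h1)
    refine ⟨y ^ q * x ^ (q - 1), ?_⟩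
    rw [pow_succ, Module.End.mul_apply]
    have : y ^ q * x ^ (q - 1) * x = (y * x) ^ q * 1 := by
      rw [mul_assoc, ← pow_succ, Nat.sub_add_cancel hq]; ring
    rw [this, h, mul_assoc]
    exact hy

end Filt

section Tr
variable {k M : Type*} [Field k] [AddCommGroup M] [Module k M]

lemma trace_eq_of_le (U U' : Submodule k M) [Module.Finite k U] [Module.Finite k U']
    (hU : U ≤ U') (T : M →ₗ[k] M) (hT : ∀ x ∈ U', T x ∈ U) :
    LinearMap.trace k U (T.restrict (fun x hx => hT x (hU hx))) =
    LinearMap.trace k U' (T.restrict (fun x hx => hU (hT x hx))) := by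
  exact LinearMap.trace_comp_comm' (Submodule.inclusion hU)
    (T.restrict (p := U') (q := U) hT)

lemma trace_comm_eq (U U' : Submodule k M) [Module.Finite k U] [Module.Finite k U']
    (hU : U ≤ U') (T A : M →ₗ[k] M) (hT : ∀ x ∈ U', T x ∈ U) (hA : ∀ x ∈ U, A x ∈ U')
    (hAT : ∀ x ∈ U', A (T x) ∈ U) :
    LinearMap.trace k U ((T ∘ₗ A).restrict (fun x hx => hT _ (hA x hx))) =
    LinearMap.trace k U ((A ∘ₗ T).restrict (fun x hx => hAT x (hU hx))) := by
  rw [trace_eq_of_le U U' hU (A ∘ₗ T) hAT]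
  exact LinearMap.trace_comp_comm' (A.restrict (p := U) (q := U') hA)
    (T.restrict (p := U') (q := U) hT)

end Tr


section Quot
variable {k C : Type*} [Field k] [CommRing C] [Algebra k C] {n : ℕ} (a : Fin n → C)

/-- ideal of coincidence of `φ` and `x ↦ x ^ Q` -/
def IQ (φ : C →ₐ[k] C) (Q : ℕ) : Ideal C := Ideal.span (Set.range fun i => φ (a i) - a i ^ Q)

lemma red (ha : Algebra.adjoin k (Set.range a) = ⊤) (φ : C →ₐ[k] C) {δ Q : ℕ}
    (hδ : ∀ i, φ (a i) ∈ V k a δ) (hQ : δ < Q) (x : C) :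
    ∃ y ∈ Submodule.span k (Set.range fun s : Fin n → Fin Q => ∏ i, a i ^ (s i : ℕ)),
      x - y ∈ IQ a φ Q := by
  classical
  set B := Submodule.span k (Set.range fun s : Fin n → Fin Q => ∏ i, a i ^ (s i : ℕ)) with hB
  set W : Submodule k C := B ⊔ (IQ a φ Q).restrictScalars k with hW
  suffices h : ∀ N, V k a N ≤ W by
    obtain ⟨N, hN⟩ := exists_mem_V (k := k) a ha x
    obtain ⟨y, hy, z, hz, rfl⟩ := Submodule.mem_sup.1 (h N hN)
    exact ⟨y, hy, by simpa using hz⟩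
  intro N
  induction N using Nat.strong_induction_on with
  | _ N ih =>
  rw [V, Submodule.span_le]
  rintro _ ⟨s, hs, rfl⟩
  by_cases hsm : ∀ i, s i < Q
  · exact Submodule.mem_sup_left (Submodule.subset_span ⟨fun i => ⟨s i, hsm i⟩, rfl⟩)
  · push Not at hsm
    obtain ⟨j, hj⟩ := hsm
    set s' : Fin n → ℕ := Function.update s j (s j - Q) with hs'
    have e : ∏ i, a i ^ s i = a j ^ Q * ∏ i, a i ^ s' i := by
      rw [← Finset.mul_prod_erase _ _ (Finset.mem_univ j),
        ← Finset.mul_prod_erase _ (fun i => a i ^ s' i) (Finset.mem_univ j), ← mul_assoc]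
      congr 1
      · rw [hs', Function.update_self, ← pow_add]; congr 1; omega
      · refine Finset.prod_congr rfl fun i hi => ?_
        rw [hs', Function.update_of_ne (Finset.ne_of_mem_erase hi)]
    have e' : ∑ i, s i = Q + ∑ i, s' i := by
      rw [← Finset.add_sum_erase _ _ (Finset.mem_univ j),
        ← Finset.add_sum_erase _ (fun i => s' i) (Finset.mem_univ j), ← add_assoc]
      congr 1
      · rw [hs', Function.update_self]; omega
      · refine Finset.sum_congr rfl fun i hi => ?_
        rw [hs', Function.update_of_ne (Finset.ne_of_mem_erase hi)]
    have e2 : ∏ i, a i ^ s i = φ (a j) * ∏ i, a i ^ s' i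
        - (φ (a j) - a j ^ Q) * ∏ i, a i ^ s' i := by rw [e]; ring
    rw [e2]
    refine sub_mem ?_ ?_
    · refine ih (δ + ∑ i, s' i) (by omega) ?_
      exact V_mul a (hδ j) (mon_mem a _ le_rfl)
    · refine Submodule.mem_sup_right ?_
      exact Ideal.mul_mem_right _ _ (Ideal.subset_span ⟨j, rfl⟩)

lemma nil_finrank {R : Type*} [CommRing R] [Algebra k R] [Module.Finite k R] {x : R} {m : ℕ}
    (hx : x ^ m = 0) : x ^ Module.finrank k R = 0 := by
  let T : Module.End k R := LinearMap.mulLeft k x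
  have hT : ∀ j, T ^ j = LinearMap.mulLeft k (x ^ j) := fun j => LinearMap.pow_mulLeft k R x j
  have hnil : IsNilpotent T := ⟨m, by rw [hT, hx]; ext; simp⟩
  have h0 : T ^ Module.finrank k R = 0 := by
    have := LinearMap.aeval_self_charpoly T
    rw [hnil.charpoly_eq_X_pow_finrank] at this
    simpa using this
  rw [hT] at h0
  have := LinearMap.congr_fun h0 1
  simpa using this

lemma nil_bound (ha : Algebra.adjoin k (Set.range a) = ⊤) (φ : C →ₐ[k] C) {δ Q : ℕ}
    (hδ : ∀ i, φ (a i) ∈ V k a δ) (hQ : δ < Q) (D : C) {m : ℕ} (hD : D ^ m ∈ IQ a φ Q) :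
    D ^ (Q ^ n) ∈ IQ a φ Q := by
  let R := C ⧸ IQ a φ Q
  let π : C →ₐ[k] R := Ideal.Quotient.mkₐ k _
  let b : (Fin n → Fin Q) → R := fun s => π (∏ i, a i ^ (s i : ℕ))
  have hb : Submodule.span k (Set.range b) = ⊤ := by
    rw [eq_top_iff]
    rintro x -
    obtain ⟨x, rfl⟩ := Ideal.Quotient.mkₐ_surjective k _ x
    obtain ⟨y, hy, hxy⟩ := red a ha φ hδ hQ x
    have : π x = π y := by
      exact (Ideal.Quotient.mk_eq_mk_iff_sub_mem _ _).2 hxy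
    change π x ∈ _
    rw [this]
    have h2 := Submodule.mem_map_of_mem (f := π.toLinearMap) hy
    rw [Submodule.map_span, ← Set.range_comp] at h2
    exact h2
  haveI : Module.Finite k R := ⟨by rw [← hb]; exact Submodule.fg_span (Set.finite_range _)⟩
  have hr : Module.finrank k R ≤ Q ^ n := by
    have := finrank_range_le_card (R := k) b
    rw [Set.finrank, hb, finrank_top] at this
    simpa using this
  have hz : π D ^ m = 0 := by
    rw [← map_pow]
    exact Ideal.Quotient.eq_zero_iff_mem.2 hD
  have := pow_eq_zero_of_le hr (nil_finrank (k := k) hz)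
  rw [← map_pow] at this
  exact Ideal.Quotient.eq_zero_iff_mem.1 this

lemma exists_algHom {F : Type*} [Field F] [IsAlgClosed F] [Algebra k F] (L : Type*) [CommRing L]
    [Algebra k L] [Nontrivial L] [Algebra.FiniteType k L] : Nonempty (L →ₐ[k] F) := by
  obtain ⟨I, hI⟩ := Ideal.exists_maximal L
  letI : Field (L ⧸ I) := Ideal.Quotient.field I
  haveI : Algebra.FiniteType k (L ⧸ I) :=
    .of_surjective (Ideal.Quotient.mkₐ k I) (Ideal.Quotient.mkₐ_surjective k _)
  haveI : Module.Finite k (L ⧸ I) := finite_of_finite_type_of_isJacobsonRing k (L ⧸ I)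
  haveI : Algebra.IsAlgebraic k (L ⧸ I) := Algebra.IsAlgebraic.of_finite _ _
  exact ⟨(IsAlgClosed.lift (R := k) (S := L ⧸ I) (M := F)).comp (Ideal.Quotient.mkₐ k I)⟩

variable [Fintype k]

lemma phi_sub_pow (ha : Algebra.adjoin k (Set.range a) = ⊤) (φ : C →ₐ[k] C) (e : ℕ) (x : C) :
    φ x - x ^ (Fintype.card k ^ e) ∈ IQ a φ (Fintype.card k ^ e) := by
  set Q := Fintype.card k ^ e
  let F : C →ₐ[k] C := (FiniteField.frobeniusAlgHom k C) ^ e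
  have hF : ∀ x, F x = x ^ Q := by
    intro x
    have : ∀ e : ℕ, ((FiniteField.frobeniusAlgHom k C) ^ e) x = x ^ (Fintype.card k ^ e) := by
      intro e
      induction e with
      | zero => simp
      | succ e ih => rw [pow_succ', AlgHom.mul_apply, ih, FiniteField.frobeniusAlgHom_apply,
          ← pow_mul, pow_succ]
    exact this e
  let π : C →ₐ[k] C ⧸ IQ a φ Q := Ideal.Quotient.mkₐ k _
  have : π.comp φ = π.comp F := by
    apply AlgHom.ext_of_adjoin_eq_top ha
    rintro _ ⟨i, rfl⟩
    refine (Ideal.Quotient.mk_eq_mk_iff_sub_mem _ _).2 ?_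
    change φ (a i) - F (a i) ∈ _
    rw [hF]
    exact Ideal.subset_span ⟨i, rfl⟩
  have h2 := AlgHom.congr_fun this x
  rw [← hF]
  exact (Ideal.Quotient.mk_eq_mk_iff_sub_mem _ _).1 h2

lemma phi_iter_mem (ha : Algebra.adjoin k (Set.range a) = ⊤) (φ : C →ₐ[k] C) (e j : ℕ) (x : C)
    (hx : x ^ ((Fintype.card k ^ e) ^ j) ∈ IQ a φ (Fintype.card k ^ e)) :
    (φ ^ j) x ∈ IQ a φ (Fintype.card k ^ e) := by
  set Q := Fintype.card k ^ e with hQ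
  have : ∀ j, (φ ^ j) x - x ^ (Q ^ j) ∈ IQ a φ Q := by
    intro j
    induction j with
    | zero => simp
    | succ j ih =>
      have h1 := phi_sub_pow a ha φ e ((φ ^ j) x)
      rw [← hQ] at h1
      have h2 : ((φ ^ j) x) ^ Q - (x ^ (Q ^ j)) ^ Q ∈ IQ a φ Q :=
        Ideal.mem_of_dvd _ (sub_dvd_pow_sub_pow _ _ Q) ih
      rw [pow_succ', AlgHom.mul_apply, pow_succ, pow_mul]
      have := add_mem h1 h2
      simpa using this
  have := add_mem (this j) hx
  simpa using this

lemma exists_point {F : Type*} [Field F] [IsAlgClosed F] [Algebra k F]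
    (ha : Algebra.adjoin k (Set.range a) = ⊤) (φ : C →ₐ[k] C) (e : ℕ) (D : C)
    (hD : ∀ m, D ^ m ∉ IQ a φ (Fintype.card k ^ e)) :
    ∃ x : C →ₐ[k] F, x D ≠ 0 ∧ ∀ c, x (φ c) = x c ^ (Fintype.card k ^ e) := by
  set Q := Fintype.card k ^ e with hQ
  let R := C ⧸ IQ a φ Q
  let π : C →ₐ[k] R := Ideal.Quotient.mkₐ k _
  let L := Localization.Away (π D)
  haveI : Nontrivial L := by
    rw [← not_subsingleton_iff_nontrivial, IsLocalization.subsingleton_iff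
      (S := L) (M := Submonoid.powers (π D))]
    rintro ⟨m, hm⟩
    refine hD m (Ideal.Quotient.eq_zero_iff_mem.1 ?_)
    change π (D ^ m) = 0
    rw [map_pow]; exact hm
  haveI : Algebra.FiniteType k C := by
    classical
    exact ⟨⟨Finset.univ.image a, by simpa using ha⟩⟩
  haveI : Algebra.FiniteType R L := inferInstance
  haveI : Algebra.FiniteType k R := .of_surjective π (Ideal.Quotient.mkₐ_surjective k _)
  haveI : Algebra.FiniteType k L := .trans (S := R) inferInstance inferInstance
  obtain ⟨y⟩ := exists_algHom (F := F) (k := k) L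
  let z : R →ₐ[k] F := y.comp (IsScalarTower.toAlgHom k R L)
  refine ⟨z.comp π, ?_, ?_⟩
  · have : IsUnit (algebraMap R L (π D)) := IsLocalization.Away.algebraMap_isUnit (π D)
    exact (this.map y).ne_zero
  · intro c
    have h1 : π (φ c) = π (c ^ Q) := by
      exact (Ideal.Quotient.mk_eq_mk_iff_sub_mem _ _).2 (phi_sub_pow a ha φ e c)
    rw [AlgHom.comp_apply, h1, ← AlgHom.comp_apply, map_pow]

end Quot


section Kap
variable {k K : Type*} [Field k] [Fintype k] [Field K] [Algebra k K]

/-- elementary form of linear independence over `K ^ (q ^ e)` -/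
def Indep (q e : ℕ) {s : ℕ} (v : Fin s → K) : Prop :=
  ∀ c : Fin s → K, ∑ i, c i ^ (q ^ e) * v i = 0 → ∀ i, c i = 0

lemma frob_apply (k : Type*) {R : Type*} [Field k] [Fintype k] [CommRing R] [Algebra k R]
    (e : ℕ) (x : R) :
    ((FiniteField.frobeniusAlgHom k R) ^ e) x = x ^ (Fintype.card k ^ e) := by
  induction e with
  | zero => simp
  | succ e ih => rw [pow_succ', AlgHom.mul_apply, ih, FiniteField.frobeniusAlgHom_apply,
      ← pow_mul, pow_succ]

lemma sub_pow_card (k : Type*) {R : Type*} [Field k] [Fintype k] [CommRing R] [Algebra k R]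
    (e : ℕ) (x y : R) : (x - y) ^ (Fintype.card k ^ e) =
      x ^ (Fintype.card k ^ e) - y ^ (Fintype.card k ^ e) := by
  simp only [← frob_apply k, map_sub]

lemma exists_indep (hK : ∀ x : K, (∀ e, ∃ y : K, y ^ (Fintype.card k ^ e) = x) →
      ∃ c : k, algebraMap k K c = x) {s : ℕ} (v : Fin s → K) (hv : LinearIndependent k v) :
    ∃ e, Indep (Fintype.card k) e v := by
  set q := Fintype.card k with hq
  have hq0 : q ≠ 0 := Fintype.card_ne_zero
  induction s with
  | zero => exact ⟨0, fun c _ i => i.elim0⟩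
  | succ s ih =>
    obtain ⟨hv1, hv2⟩ := linearIndependent_finSucc'.1 hv
    obtain ⟨e0, h0⟩ := ih (Fin.init v) hv1
    by_contra hcon
    push Not at hcon
    have h1 : ∀ j : ℕ, ∃ d : Fin s → K,
        v (Fin.last s) = ∑ i, (d i ^ (q ^ j)) ^ (q ^ e0) * Fin.init v i := by
      intro j
      have := hcon (j + e0)
      unfold Indep at this
      push Not at this
      obtain ⟨c, hc, i0, hi0⟩ := this
      rw [Fin.sum_univ_castSucc] at hc
      have hl : c (Fin.last s) ≠ 0 := by
        intro hl
        rw [hl, zero_pow (pow_ne_zero _ hq0), zero_mul, add_zero] at hc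
        have := h0 (fun i => c i.castSucc ^ (q ^ j)) (by
          simpa only [← pow_mul, ← pow_add, Fin.init] using hc)
        refine hi0 ?_
        induction i0 using Fin.lastCases with
        | last => exact hl
        | cast i => exact eq_zero_of_pow_eq_zero (this i)
      refine ⟨fun i => (0 - c i.castSucc) / c (Fin.last s), ?_⟩
      simp only [← pow_mul, ← pow_add, div_pow]
      rw [hq]
      simp only [sub_pow_card k]
      rw [← hq, zero_pow (pow_ne_zero _ hq0)]
      have hl' : c (Fin.last s) ^ q ^ (j + e0) ≠ 0 := pow_ne_zero _ hl
      have : ∀ i : Fin s, (0 - c i.castSucc ^ q ^ (j + e0)) / c (Fin.last s) ^ q ^ (j + e0)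
          * Fin.init v i = -(c i.castSucc ^ q ^ (j + e0) * v i.castSucc) *
            (c (Fin.last s) ^ q ^ (j + e0))⁻¹ := by
        intro i
        simp only [Fin.init]
        rw [div_eq_mul_inv]; ring
      simp only [this]
      rw [← Finset.sum_mul, Finset.sum_neg_distrib, eq_neg_of_add_eq_zero_left hc]
      field_simp
    obtain ⟨d0, hd0⟩ := h1 0
    simp only [pow_zero, pow_one] at hd0
    have h2 : ∀ i, ∃ c : k, algebraMap k K c = d0 i := by
      intro i
      apply hK
      intro j
      obtain ⟨d, hd⟩ := h1 j
      refine ⟨d i, ?_⟩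
      have := h0 (fun i => d i ^ (q ^ j) - d0 i) (by
        rw [hq]
        simp only [sub_pow_card k, sub_mul, Finset.sum_sub_distrib]
        rw [← hq, ← hd0, ← hd, sub_self]) i
      exact sub_eq_zero.1 this
    choose r hr using h2
    apply hv2
    rw [hd0]
    refine Submodule.sum_mem _ fun i _ => ?_
    rw [← hr, ← map_pow, ← Algebra.smul_def]
    exact Submodule.smul_mem _ _ (Submodule.subset_span ⟨i, rfl⟩)

lemma exists_kappaK (e : ℕ) {s : ℕ} (v : Fin s → K) (hv : Indep (Fintype.card k) e v) :
    ∃ κ : Fin s → (K →ₗ[k] K), (∀ i, IsK (Fintype.card k ^ e) (κ i)) ∧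
      ∀ i j, κ i (v j) = if i = j then 1 else 0 := by
  classical
  set q := Fintype.card k with hq
  let σ : K →ₐ[k] K := (FiniteField.frobeniusAlgHom k K) ^ e
  have hσ : ∀ x, σ x = x ^ (q ^ e) := frob_apply k e
  let L := σ.fieldRange
  have hv' : LinearIndependent L v := by
    rw [Fintype.linearIndependent_iff]
    intro g hg i
    choose c hc using fun i => (g i).2
    have hc' : ∀ i, (g i : K) = c i ^ (q ^ e) := fun i => by
      rw [← hσ]; exact (hc i).symm
    have := hv c (by
      rw [← hg]
      refine Finset.sum_congr rfl fun i _ => ?_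
      rw [← hc', Algebra.smul_def]; rfl) i
    apply Subtype.ext
    rw [hc', this]
    simp [hq]
  let τ : K ≃ₐ[k] L := AlgEquiv.ofInjectiveField σ
  have hτ : ∀ x, ((τ x : L) : K) = x ^ (q ^ e) := fun x => hσ x
  let b := Module.Basis.extend hv'.linearIndepOn_id
  have hmem : ∀ j, v j ∈ hv'.linearIndepOn_id.extend (Set.subset_univ (Set.range v)) := fun j =>
    hv'.linearIndepOn_id.subset_extend _ ⟨j, rfl⟩
  have hb : ∀ j, b ⟨v j, hmem j⟩ = v j := fun j => by
    exact Module.Basis.extend_apply_self _ _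
  let g : Fin s → (K →ₗ[L] L) := fun i => b.coord ⟨v i, hmem i⟩
  have hg : ∀ i j, g i (v j) = if i = j then 1 else 0 := by
    intro i j
    change b.repr (v j) _ = _
    rw [← hb j, b.repr_self, Finsupp.single_apply]
    have hinj := hv'.injective
    by_cases hij : i = j
    · subst hij; simp
    · rw [if_neg, if_neg hij]
      intro h
      exact hij (hinj (congrArg Subtype.val h)).symm
  refine ⟨fun i => τ.symm.toLinearMap ∘ₗ (g i).restrictScalars k, ?_, ?_⟩
  · intro i x y
    simp only [LinearMap.comp_apply, LinearMap.restrictScalars_apply, AlgEquiv.toLinearMap_apply]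
    have : x ^ (q ^ e) * y = (τ x) • y := by
      rw [Algebra.smul_def, ← hτ]; rfl
    rw [this, map_smul, smul_eq_mul, map_mul, AlgEquiv.symm_apply_apply]
  · intro i j
    simp only [LinearMap.comp_apply, LinearMap.restrictScalars_apply, AlgEquiv.toLinearMap_apply]
    rw [hg]
    split_ifs <;> simp

lemma exists_kappa {C : Type*} [CommRing C] [IsDomain C] [Algebra k C] [Algebra C K]
    [IsScalarTower k C K] [IsFractionRing C K] {n : ℕ} (a : Fin n → C)
    (ha : Algebra.adjoin k (Set.range a) = ⊤)
    (e : ℕ) {s : ℕ} (v : Fin s → C) (hv : Indep (Fintype.card k) e (fun i => algebraMap C K (v i))) :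
    ∃ (h : C) (κ : Fin s → (C →ₗ[k] C)), h ≠ 0 ∧ (∀ i, IsK (Fintype.card k ^ e) (κ i)) ∧
      ∀ i j, κ i (v j) = if i = j then h else 0 := by
  set q := Fintype.card k with hq
  have hQ : 0 < q ^ e := pow_pos Fintype.card_pos _
  obtain ⟨κ, hκ, hκv⟩ := exists_kappaK e _ hv
  obtain ⟨b, hb⟩ := IsLocalization.exist_integer_multiples_of_finite (nonZeroDivisors C)
    (fun t : Fin s × (Fin n → Fin (q ^ e)) => κ t.1 (algebraMap C K (∏ i, a i ^ (t.2 i : ℕ))))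
  have hinj : Function.Injective (algebraMap C K) := IsFractionRing.injective C K
  have h1 : ∀ i x, ∃ y : C, algebraMap C K y = algebraMap C K b * κ i (algebraMap C K x) := by
    intro i x
    obtain ⟨N, hN⟩ := exists_mem_V (k := k) a ha x
    induction hN using Submodule.span_induction with
    | mem x hx =>
      obtain ⟨t, ht, rfl⟩ := hx
      have he : ∏ i, a i ^ t i = (∏ i, a i ^ (t i / q ^ e)) ^ (q ^ e) *
          ∏ i, a i ^ (t i % q ^ e) := by
        rw [← Finset.prod_pow, ← Finset.prod_mul_distrib]
        refine Finset.prod_congr rfl fun i _ => ?_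
        rw [← pow_mul, ← pow_add, Nat.div_add_mod']
      obtain ⟨y, hy⟩ := hb (i, fun j => ⟨t j % q ^ e, Nat.mod_lt _ hQ⟩)
      refine ⟨(∏ i, a i ^ (t i / q ^ e)) * y, ?_⟩
      rw [he, map_mul, map_mul, map_pow, hκ, hy, Algebra.smul_def]
      ring
    | zero => exact ⟨0, by simp⟩
    | add x y _ _ hx hy =>
      obtain ⟨x', hx⟩ := hx
      obtain ⟨y', hy⟩ := hy
      exact ⟨x' + y', by simp only [map_add, mul_add, hx, hy]⟩
    | smul c x _ hx =>
      obtain ⟨x', hx⟩ := hx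
      refine ⟨c • x', ?_⟩
      have : ∀ z : C, algebraMap C K (c • z) = c • algebraMap C K z := fun z => by
        rw [Algebra.smul_def, map_mul, ← IsScalarTower.algebraMap_apply, Algebra.smul_def]
      rw [this, this, map_smul, hx, mul_smul_comm]
  choose f hf using h1
  refine ⟨b, fun i => { toFun := f i, map_add' := ?_, map_smul' := ?_ }, ?_, ?_, ?_⟩
  · intro x y
    apply hinj
    simp only [map_add, hf, mul_add]
  · intro c x
    apply hinj
    have : ∀ z : C, algebraMap C K (c • z) = c • algebraMap C K z := fun z => by
      rw [Algebra.smul_def, map_mul, ← IsScalarTower.algebraMap_apply, Algebra.smul_def]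
    simp only [hf, this, map_smul, mul_smul_comm, RingHom.id_apply]
  · exact nonZeroDivisors.coe_ne_zero b
  · intro i x y
    apply hinj
    simp only [LinearMap.coe_mk, AddHom.coe_mk, map_mul, hf, map_pow]
    rw [hκ]; ring
  · intro i j
    apply hinj
    simp only [LinearMap.coe_mk, AddHom.coe_mk, hf, hκv]
    split_ifs <;> simp

end Kap


section Core
variable {k C : Type*} [Field k] [CommRing C] [Algebra k C] {n : ℕ} (a : Fin n → C)

/-- the operator `v ↦ κ (b φ(v))` -/
def TT (φ : C →ₐ[k] C) (κ : C →ₗ[k] C) (b : C) : C →ₗ[k] C :=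
  κ ∘ₗ LinearMap.mulLeft k b ∘ₗ φ.toLinearMap

lemma TT_apply (φ : C →ₐ[k] C) (κ : C →ₗ[k] C) (b x : C) : TT φ κ b x = κ (b * φ x) := rfl

lemma TT_bound (φ : C →ₐ[k] C) {δ Q c β : ℕ} (hδ : ∀ i, φ (a i) ∈ V k a δ)
    {κ : C →ₗ[k] C} (hc : ∀ N, ∀ x ∈ V k a N, κ x ∈ V k a (N / Q + c)) {b : C}
    (hb : b ∈ V k a β) {M : ℕ} {x : C} (hx : x ∈ V k a M) :
    TT φ κ b x ∈ V k a ((β + δ * M) / Q + c) :=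
  hc _ _ (V_mul a hb (map_V a φ hδ hx))

lemma trace_sub' {k M : Type*} [Field k] [AddCommGroup M] [Module k M] (f g : M →ₗ[k] M) :
    LinearMap.trace k M (f - g) = LinearMap.trace k M f - LinearMap.trace k M g := by
  simp

lemma trace_zero (ha : Algebra.adjoin k (Set.range a) = ⊤) (φ : C →ₐ[k] C) {δ Q c : ℕ}
    (hδ : ∀ i, φ (a i) ∈ V k a δ) {κ : C →ₗ[k] C} (hκ : IsK Q κ)
    (hc : ∀ N, ∀ x ∈ V k a N, κ x ∈ V k a (N / Q + c)) (hQ : 2 * δ ≤ Q) (hQ0 : 0 < Q)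
    {E : C} (hE : E ∈ IQ a φ Q) :
    ∃ N0, ∀ N, N0 ≤ N → ∀ h : (∀ x ∈ V k a N, TT φ κ E x ∈ V k a N),
      LinearMap.trace k (V k a N) ((TT φ κ E).restrict h) = 0 := by
  obtain ⟨b, hb⟩ := Ideal.mem_span_range_iff_exists_fun.1 hE
  obtain ⟨β, hβ⟩ := exists_mem_V_fin (k := k) a ha b
  refine ⟨2 * β + 2 * c + 3, fun N hN h => ?_⟩
  have hT : ∀ i, ∀ x ∈ V k a (N + 1), TT φ κ (b i) x ∈ V k a (N - 1) := by
    intro i x hx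
    refine V_mono a ?_ (TT_bound a φ hδ hc (hβ i) hx)
    have : (β + δ * (N + 1)) / Q ≤ N - 1 - c := by
      apply Nat.div_le_of_le_mul
      obtain ⟨y, hy⟩ : ∃ y, y = N - 1 - c := ⟨_, rfl⟩
      rw [← hy]
      have h1 : 2 * β + N + 1 ≤ 2 * y := by omega
      have h2 := Nat.mul_le_mul_left Q h1
      have h3 := Nat.mul_le_mul_right (N + 1) hQ
      have h4 := Nat.mul_le_mul_right β hQ0
      nlinarith
    omega
  have hT' : ∀ i, ∀ x ∈ V k a (N + 1), TT φ κ (b i) x ∈ V k a N := fun i x hx =>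
    V_mono a (by omega) (hT i x hx)
  have hA : ∀ i, ∀ x ∈ V k a N, LinearMap.mulLeft k (a i) x ∈ V k a (N + 1) := fun i x hx => by
    rw [LinearMap.mulLeft_apply, add_comm]
    exact V_mul a (gen_mem_V a i) hx
  have hAT : ∀ i, ∀ x ∈ V k a (N + 1), LinearMap.mulLeft k (a i) (TT φ κ (b i) x) ∈ V k a N :=
    fun i x hx => by
      rw [LinearMap.mulLeft_apply]
      have := V_mul a (gen_mem_V (k := k) a i) (hT i x hx)
      rwa [show 1 + (N - 1) = N by omega] at this
  have hle : V k a N ≤ V k a (N + 1) := V_mono a (by omega)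
  have e : (TT φ κ E).restrict h = ∑ i,
      (((TT φ κ (b i)) ∘ₗ LinearMap.mulLeft k (a i)).restrict (fun x hx => hT' i _ (hA i x hx)) -
      (LinearMap.mulLeft k (a i) ∘ₗ (TT φ κ (b i))).restrict (fun x hx => hAT i x (hle hx))) := by
    ext x
    simp only [LinearMap.sum_apply, LinearMap.sub_apply, Submodule.coe_sum, Submodule.coe_sub,
      LinearMap.coe_restrict_apply, LinearMap.comp_apply, TT_apply, LinearMap.mulLeft_apply]
    rw [← hb, Finset.sum_mul, map_sum]
    refine Finset.sum_congr rfl fun i _ => ?_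
    rw [← hκ, ← map_sub, map_mul φ]
    congr 1; ring
  rw [e, map_sum]
  refine Finset.sum_eq_zero fun i _ => ?_
  refine (trace_sub' _ _).trans (sub_eq_zero.2 ?_)
  exact trace_comm_eq (V k a N) (V k a (N + 1)) hle _ _ (hT' i) (hA i) (hAT i)

variable [IsDomain C] [Fintype k] {K : Type*} [Field K] [Algebra k K] [Algebra C K]
    [IsScalarTower k C K] [IsFractionRing C K]

lemma core_not_mem (ha : Algebra.adjoin k (Set.range a) = ⊤) (φ : C →ₐ[k] C)
    (hφ : Function.Injective φ)
    (hK : ∀ x : K, (∀ e, ∃ y : K, y ^ (Fintype.card k ^ e) = x) → ∃ c : k, algebraMap k K c = x)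
    {E : C} (hE : E ≠ 0) (Qm : ℕ) :
    ∃ e, Qm < Fintype.card k ^ e ∧ E ∉ IQ a φ (Fintype.card k ^ e) := by
  classical
  set q := Fintype.card k with hq
  have hq2 : 2 ≤ q := Fintype.one_lt_card
  obtain ⟨δ, hδ⟩ := exists_mem_V_fin (k := k) a ha (fun i => φ (a i))
  obtain ⟨ε, hε⟩ := exists_mem_V (k := k) a ha E
  obtain ⟨hs, κs, hs0, hκs, hκs1⟩ := exists_kappa (K := K) a ha 1 (s := 1) (fun _ => (1 : C)) (by
    intro c hc i
    simp only [Finset.univ_unique, Finset.sum_singleton, map_one, mul_one] at hc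
    rw [Subsingleton.elim i default]
    exact eq_zero_of_pow_eq_zero hc)
  have hκ := hκs 0
  have h1 := hκs1 0 0
  rw [if_pos rfl] at h1
  generalize κs 0 = κ at hκ h1
  rw [pow_one] at hκ
  obtain ⟨cs, hcs⟩ := hκ.bound a ha (by omega)
  have hit := iter_bound a hq2 hcs
  obtain ⟨c1, hc1⟩ : ∃ c1, c1 = n + 1 + (2 * cs + 2) := ⟨_, rfl⟩
  obtain ⟨c2, hc2⟩ : ∃ c2, c2 = 2 * c1 + 2 := ⟨_, rfl⟩
  let B := Module.finBasis k (V k a c2)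
  have hinj : Function.Injective (algebraMap C K) := IsFractionRing.injective C K
  let v' : Fin (Module.finrank k (V k a c2)) → C := fun j => E * φ (B j : C)
  have hv' : LinearIndependent k (fun j => algebraMap C K (v' j)) := by
    let ℓ : V k a c2 →ₗ[k] K := (IsScalarTower.toAlgHom k C K).toLinearMap ∘ₗ
      LinearMap.mulLeft k E ∘ₗ φ.toLinearMap ∘ₗ (V k a c2).subtype
    have : Function.Injective ℓ := by
      intro x y hxy
      exact Subtype.ext (hφ (mul_left_cancel₀ hE (hinj hxy)))
    exact B.linearIndependent.map' ℓ (LinearMap.ker_eq_bot.2 this)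
  obtain ⟨e0, he0⟩ := exists_indep hK _ hv'
  obtain ⟨h, κ0, hh0, hκ0, hκ0v⟩ := exists_kappa a ha e0 v' he0
  choose cc hcc using fun i => (hκ0 i).bound a ha (pow_pos (by omega : 0 < q) e0)
  obtain ⟨ch, hch⟩ := exists_mem_V (k := k) a ha h
  obtain ⟨c0, hc0⟩ : ∃ c0, c0 = ch + ∑ i, cc i := ⟨_, rfl⟩
  have hcc' : ∀ i, cc i ≤ c0 := fun i => by
    have := Finset.single_le_sum (f := cc) (fun _ _ => Nat.zero_le _) (Finset.mem_univ i)
    omega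
  obtain ⟨e1, he1⟩ : ∃ e1, c0 + 2 * (δ + ε + 1) + Qm < q ^ e1 :=
    ⟨_, Nat.lt_pow_self (n := c0 + 2 * (δ + ε + 1) + Qm) hq2⟩
  have hQ1 : 0 < q ^ e1 := pow_pos (by omega) _
  have hQ0 : 0 < q ^ e0 := pow_pos (by omega) _
  have hQQ : q ^ e1 ≤ q ^ (e0 + e1) := by
    rw [pow_add]; exact Nat.le_mul_of_pos_left _ hQ0
  refine ⟨e0 + e1, by omega, fun hmem => ?_⟩
  obtain ⟨t, ht⟩ : ∃ t : Fin n → Fin (q ^ e1), (κ ^ e1) ((∏ i, a i ^ (t i : ℕ)) * h) ≠ 0 := by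
    by_contra hcon
    push Not at hcon
    obtain ⟨u, hu⟩ := iter_ne (by omega) hκ (by rw [h1]; exact hs0) e1 h hh0
    exact hu (small_span a ha hQ1 (hκ.iter e1) h hcon u)
  obtain ⟨u, hu⟩ : ∃ u, u = ∏ i, a i ^ (t i : ℕ) := ⟨_, rfl⟩
  have huV : u ∈ V k a (n * q ^ e1) := by
    rw [hu]
    refine mon_mem a _ ?_
    calc ∑ i, (t i : ℕ) ≤ ∑ i : Fin n, q ^ e1 := Finset.sum_le_sum fun i _ => (t i).2.le
      _ = n * q ^ e1 := by simp
  rw [← hu] at ht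
  obtain ⟨w, hw⟩ : ∃ w, w = (κ ^ e1) (u * h) := ⟨_, rfl⟩
  rw [← hw] at ht
  have hdiv : ∀ y, (n * q ^ e1 + (y + c0)) / q ^ e1 ≤ n + 1 + y / q ^ e1 := by
    intro y
    calc (n * q ^ e1 + (y + c0)) / q ^ e1 ≤ (y + (n + 1) * q ^ e1) / q ^ e1 := by
          apply Nat.div_le_div_right
          rw [add_mul]; omega
      _ = n + 1 + y / q ^ e1 := by rw [Nat.add_mul_div_right _ _ hQ1, add_comm]
  have hwV : w ∈ V k a c2 := by
    rw [hw]
    refine V_mono a ?_ (hit e1 _ _ (V_mul a huV (V_mono a (by omega : ch ≤ 0 + c0) hch)))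
    have := hdiv 0
    simp only [Nat.zero_div, add_zero] at this
    omega
  have hwB : (⟨w, hwV⟩ : V k a c2) ≠ 0 := fun h0 => ht (congrArg Subtype.val h0)
  obtain ⟨i, hi⟩ : ∃ i, B.coord i ⟨w, hwV⟩ ≠ 0 := by
    by_contra hcon
    push Not at hcon
    exact hwB (B.forall_coord_eq_zero_iff.1 hcon)
  let κ' : C →ₗ[k] C := ((κ ^ e1) ∘ₗ LinearMap.mulLeft k u) ∘ₗ κ0 i
  have hκ' : IsK (q ^ (e0 + e1)) κ' := by
    rw [pow_add]
    exact (hκ0 i).comp ((hκ.iter e1).mulR u)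
  have hκ'c : ∀ N, ∀ x ∈ V k a N, κ' x ∈ V k a (N / q ^ (e0 + e1) + c1) := by
    intro N x hx
    refine V_mono a ?_ (hit e1 _ _ (V_mul a huV
      (V_mono a (by have := hcc' i; omega : _ ≤ N / q ^ e0 + c0) (hcc i N x hx))))
    have := hdiv (N / q ^ e0)
    rw [Nat.div_div_eq_div_mul, ← pow_add] at this
    omega
  have hstep : ∀ N, c2 ≤ N → ∀ x ∈ V k a (N + 1), TT φ κ' E x ∈ V k a N := by
    intro N hN x hx
    refine V_mono a ?_ (TT_bound a φ hδ hκ'c hε hx)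
    have : (ε + δ * (N + 1)) / q ^ (e0 + e1) ≤ (N + 1) / 2 := by
      rw [Nat.le_div_iff_mul_le (by norm_num)]
      have h2 : (ε + δ * (N + 1)) * 2 ≤ q ^ (e0 + e1) * (N + 1) := by
        have h3 : 2 * (δ + ε) ≤ q ^ (e0 + e1) := by omega
        have h4 := Nat.mul_le_mul_right (N + 1) h3
        have h5 : ε ≤ ε * (N + 1) := Nat.le_mul_of_pos_right _ (by omega)
        nlinarith
      have h3 := Nat.div_mul_le_self (ε + δ * (N + 1)) (q ^ (e0 + e1))
      have h4 : 0 < q ^ (e0 + e1) := by omega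
      refine Nat.le_of_mul_le_mul_left ?_ h4
      nlinarith
    omega
  have hself : ∀ N, c2 ≤ N → ∀ x ∈ V k a N, TT φ κ' E x ∈ V k a N := fun N hN x hx =>
    hstep N hN x (V_mono a (by omega) hx)
  have htr : ∀ N (hN : c2 ≤ N), LinearMap.trace k _ ((TT φ κ' E).restrict (hself N hN)) =
      B.coord i ⟨w, hwV⟩ := by
    intro N hN
    induction N, hN using Nat.le_induction with
    | base =>
      have : (TT φ κ' E).restrict (hself c2 le_rfl) =
          (B.coord i).smulRight (⟨w, hwV⟩ : V k a c2) := by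
        refine B.ext fun j => ?_
        apply Subtype.ext
        simp only [LinearMap.coe_restrict_apply, LinearMap.smulRight_apply, TT_apply, κ',
          LinearMap.comp_apply, Module.Basis.coord_apply, Module.Basis.repr_self]
        have := hκ0v i j
        simp only [v'] at this
        rw [this, Finsupp.single_apply]
        by_cases hij : i = j
        · rw [if_pos hij, if_pos hij.symm, LinearMap.mulLeft_apply, ← hw]; simp
        · rw [if_neg hij, if_neg (Ne.symm hij)]; simp
      rw [this, LinearMap.trace_smulRight]
    | succ N hN ih =>
      rw [← ih]
      exact (trace_eq_of_le (V k a N) (V k a (N + 1)) (V_mono a (by omega)) _ (hstep N hN)).symm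
  obtain ⟨N0, hN0⟩ := trace_zero a ha φ hδ hκ' hκ'c (by omega) (by omega) hmem
  apply hi
  rw [← htr (max c2 N0) (le_max_left _ _)]
  exact hN0 _ (le_max_right _ _) _

theorem core {F : Type*} [Field F] [IsAlgClosed F] [Algebra k F]
    (ha : Algebra.adjoin k (Set.range a) = ⊤) (φ : C →ₐ[k] C)
    (hφ : Function.Injective φ)
    (hK : ∀ x : K, (∀ e, ∃ y : K, y ^ (Fintype.card k ^ e) = x) → ∃ c : k, algebraMap k K c = x)
    {D : C} (hD : D ≠ 0) :
    ∃ (e : ℕ) (x : C →ₐ[k] F), 1 ≤ e ∧ x D ≠ 0 ∧ ∀ c, x (φ c) = x c ^ (Fintype.card k ^ e) := by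
  obtain ⟨δ, hδ⟩ := exists_mem_V_fin (k := k) a ha (fun i => φ (a i))
  have hφn : ∀ j : ℕ, Function.Injective (φ ^ j : C →ₐ[k] C) := by
    intro j
    induction j with
    | zero => exact fun x y h => by simpa using h
    | succ j ih =>
      rw [pow_succ]
      exact ih.comp hφ
  have hE : (φ ^ n) D ≠ 0 := by
    rw [Ne, map_eq_zero_iff _ (hφn n)]; exact hD
  obtain ⟨e, he, hnot⟩ := core_not_mem (K := K) a ha φ hφ hK hE (δ + 1)
  obtain ⟨x, hx⟩ := exists_point (F := F) a ha φ e D (fun m hm => hnot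
    (phi_iter_mem a ha φ e n D (nil_bound a ha φ hδ (by omega) D hm)))
  refine ⟨e, x, ?_, hx⟩
  rcases Nat.eq_zero_or_pos e with rfl | h
  · simp at he
  · exact h

end Core


section FieldL

lemma totalDegree_pow' {k : Type*} [Field k] {σ : Type*} (f : MvPolynomial σ k) (n : ℕ) :
    (f ^ n).totalDegree = n * f.totalDegree := by
  by_cases hf : f = 0
  · subst hf
    rcases n with _ | n <;> simp
  induction n with
  | zero => simp
  | succ n ih =>
    rw [pow_succ, MvPolynomial.totalDegree_mul_of_isDomain (pow_ne_zero _ hf) hf, ih]; ring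

variable {k : Type*} [Field k] [Fintype k]

lemma ratfunc_perf {d : ℕ} (P : Type*) [Field P] [Algebra (MvPolynomial (Fin d) k) P]
    [IsFractionRing (MvPolynomial (Fin d) k) P] [Algebra k P]
    [IsScalarTower k (MvPolynomial (Fin d) k) P] (x : P)
    (hx : ∀ e, ∃ y : P, y ^ (Fintype.card k ^ e) = x) : ∃ c : k, algebraMap k P c = x := by
  set q := Fintype.card k with hq
  have hq2 : 2 ≤ q := Fintype.one_lt_card
  let S := MvPolynomial (Fin d) k
  let nx := IsFractionRing.num S x
  let dx : S := IsFractionRing.den S x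
  obtain ⟨e, he⟩ : ∃ e, nx.totalDegree + dx.totalDegree < q ^ e :=
    ⟨_, Nat.lt_pow_self (n := nx.totalDegree + dx.totalDegree) hq2⟩
  obtain ⟨y, hy⟩ := hx e
  let ny := IsFractionRing.num S y
  let dy := IsFractionRing.den S y
  have hpr : IsRelPrime (ny ^ (q ^ e)) ((dy ^ (q ^ e) : nonZeroDivisors S) : S) := by
    rw [SubmonoidClass.coe_pow]
    exact (IsFractionRing.num_den_reduced S y).pow
  have hmk : IsLocalization.mk' P (ny ^ (q ^ e)) (dy ^ (q ^ e)) = x := by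
    rw [IsLocalization.mk'_pow, IsFractionRing.mk'_num_den, hy]
  obtain ⟨h1, h2⟩ := IsFractionRing.num_den_unique S x _ _ hpr hmk
  have key : ∀ f g : S, Associated f (g ^ (q ^ e)) → f.totalDegree < q ^ e →
      f.totalDegree = 0 := by
    intro f g hfg hf
    by_cases hf0 : f = 0
    · rw [hf0]; exact MvPolynomial.totalDegree_zero
    have h3 := MvPolynomial.totalDegree_le_of_dvd_of_isDomain hfg.symm.dvd hf0
    rw [totalDegree_pow'] at h3
    have h4 : g.totalDegree = 0 := by
      by_contra h5
      have := Nat.le_mul_of_pos_right (q ^ e) (Nat.pos_of_ne_zero h5)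
      omega
    have h6 : g ^ (q ^ e) ≠ 0 := fun h => hf0 (by rwa [h, associated_zero_iff_eq_zero] at hfg)
    have h5 := MvPolynomial.totalDegree_le_of_dvd_of_isDomain hfg.dvd h6
    rw [totalDegree_pow', h4] at h5
    omega
  have hn := MvPolynomial.totalDegree_eq_zero_iff_eq_C.1 (key nx ny h1 (by omega))
  have hd := MvPolynomial.totalDegree_eq_zero_iff_eq_C.1 (key dx dy h2 (by omega))
  refine ⟨MvPolynomial.coeff 0 nx / MvPolynomial.coeff 0 dx, ?_⟩
  have := IsFractionRing.mk'_num_den' S x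
  change algebraMap S P nx / algebraMap S P dx = x at this
  rw [hn, hd] at this
  rw [map_div₀, IsScalarTower.algebraMap_apply k S P, IsScalarTower.algebraMap_apply k S P]
  exact this

lemma finite_perf {P K : Type*} [Field P] [Field K] [Algebra k P] [Algebra k K] [Algebra P K]
    [IsScalarTower k P K] [FiniteDimensional P K]
    (hP : ∀ x : P, (∀ e, ∃ y : P, y ^ (Fintype.card k ^ e) = x) → ∃ c : k, algebraMap k P c = x) :
    ∃ M, 1 ≤ M ∧ ∀ x : K, (∀ e, ∃ y : K, y ^ (Fintype.card k ^ e) = x) →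
      x ^ (Fintype.card k ^ M) = x := by
  set q := Fintype.card k with hq
  set m := Module.finrank P K with hm
  refine ⟨m.factorial, Nat.factorial_pos _, fun x hx => ?_⟩
  choose y hy using hx
  have hIntg : ∀ z : K, IsIntegral P z := fun z => Algebra.IsIntegral.isIntegral z
  have hdeg : ∀ z : K, (minpoly P z).natDegree ≤ m := fun z => minpoly.natDegree_le z
  obtain ⟨e1, he1⟩ : ∃ e1, ∀ e, (minpoly P (y e)).natDegree ≤ (minpoly P (y e1)).natDegree := by
    have hfin : (Set.range fun e => (minpoly P (y e)).natDegree).Finite :=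
      (Set.finite_Iic m).subset (by rintro _ ⟨e, rfl⟩; exact hdeg _)
    obtain ⟨_, ⟨e1, rfl⟩, h⟩ := Set.exists_max_image _ id hfin (Set.range_nonempty _)
    exact ⟨e1, fun e => h _ ⟨e, rfl⟩⟩
  have hinjK : ∀ (e : ℕ) (u v : K), u ^ (q ^ e) = v ^ (q ^ e) → u = v := by
    intro e u v h
    have := sub_pow_card k e u v
    rw [← hq, h, sub_self] at this
    exact sub_eq_zero.1 (eq_zero_of_pow_eq_zero this)
  have hroot : ∀ j, (y (e1 + j)) ^ (q ^ j) = y e1 := by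
    intro j
    apply hinjK e1
    rw [← pow_mul, ← pow_add, add_comm j e1, hy, hy]
  have hcoef : ∀ j i, ∃ c : P, c ^ (q ^ j) = (minpoly P (y e1)).coeff i := by
    intro j i
    let σ : P →+* P := ((FiniteField.frobeniusAlgHom k P) ^ j : P →ₐ[k] P)
    let τ : K →+* K := ((FiniteField.frobeniusAlgHom k K) ^ j : K →ₐ[k] K)
    have hσ : ∀ x, σ x = x ^ (q ^ j) := frob_apply k j
    have hτ : ∀ x, τ x = x ^ (q ^ j) := frob_apply k j
    let p := (minpoly P (y (e1 + j))).map σ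
    have hmon : p.Monic := (minpoly.monic (hIntg _)).map σ
    have hcomp : τ.comp (algebraMap P K) = (algebraMap P K).comp σ := by
      ext z
      simp [hσ, hτ]
    have h0 : Polynomial.aeval (y e1) p = 0 := by
      rw [← hroot j, ← hτ, Polynomial.aeval_def, Polynomial.eval₂_map, ← hcomp,
        ← Polynomial.hom_eval₂, ← Polynomial.aeval_def, minpoly.aeval, map_zero]
    have hdvd := minpoly.dvd P (y e1) h0
    have hnd : p.natDegree ≤ (minpoly P (y e1)).natDegree := by
      rw [Polynomial.natDegree_map]
      exact he1 _
    have heq : minpoly P (y e1) = p :=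
      (Polynomial.eq_of_monic_of_dvd_of_natDegree_le (minpoly.monic (hIntg _)) hmon hdvd hnd).symm
    refine ⟨(minpoly P (y (e1 + j))).coeff i, ?_⟩
    rw [heq, Polynomial.coeff_map, hσ]
  have hlift : minpoly P (y e1) ∈ Polynomial.lifts (algebraMap k P) := by
    rw [Polynomial.lifts_iff_coeff_lifts]
    intro i
    exact hP _ fun j => hcoef j i
  obtain ⟨g, hg1, hg2, hg3⟩ := Polynomial.lifts_and_natDegree_eq_and_monic hlift
    (minpoly.monic (hIntg _))
  have hgy : Polynomial.aeval (y e1) g = 0 := by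
    rw [← Polynomial.aeval_map_algebraMap P, hg1, minpoly.aeval]
  have hi : IsIntegral k (y e1) := ⟨g, hg3, hgy⟩
  let L := IntermediateField.adjoin k {y e1}
  haveI : FiniteDimensional k L := IntermediateField.adjoin.finiteDimensional hi
  have hr : Module.finrank k L ≤ m := by
    rw [IntermediateField.adjoin.finrank hi]
    refine (Polynomial.natDegree_le_of_dvd (minpoly.dvd k _ hgy) hg3.ne_zero).trans ?_
    rw [hg2]; exact hdeg _
  haveI : Finite L := Module.finite_of_finite k
  letI : Fintype L := Fintype.ofFinite L
  have hcard : Fintype.card L = q ^ Module.finrank k L := Module.card_eq_pow_finrank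
  obtain ⟨s, hs⟩ := Nat.dvd_factorial Module.finrank_pos hr
  have hyy : y e1 ^ (q ^ m.factorial) = y e1 := by
    have := FiniteField.pow_card_pow (K := L) s ⟨y e1, IntermediateField.mem_adjoin_simple_self k _⟩
    rw [hcard, ← pow_mul, ← hs] at this
    exact congrArg Subtype.val this
  rw [← hy e1, ← pow_mul, mul_comm, pow_mul, hyy]

lemma lemmaL {C K : Type*} [CommRing C] [IsDomain C] [Algebra k C] [Algebra.FiniteType k C]
    [Field K] [Algebra C K] [IsFractionRing C K] [Algebra k K] [IsScalarTower k C K] :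
    ∃ M, 1 ≤ M ∧ ∀ x : K, (∀ e, ∃ y : K, y ^ (Fintype.card k ^ e) = x) →
      x ^ (Fintype.card k ^ M) = x := by
  obtain ⟨d, g, hg, hfin⟩ := exists_finite_inj_algHom_of_fg k C
  let S := MvPolynomial (Fin d) k
  letI : Algebra S C := g.toRingHom.toAlgebra
  haveI : Module.Finite S C := hfin
  letI : Algebra S K := ((algebraMap C K).comp g.toRingHom).toAlgebra
  haveI : IsScalarTower S C K := .of_algebraMap_eq fun _ => rfl
  have hinjSC : Function.Injective (algebraMap S C) := hg
  haveI : FaithfulSMul S C := (faithfulSMul_iff_algebraMap_injective S C).2 hinjSC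
  haveI : FaithfulSMul S K := (faithfulSMul_iff_algebraMap_injective S K).2
    ((IsFractionRing.injective C K).comp hg)
  haveI : IsScalarTower k S K := .of_algebraMap_eq fun r => by
    change _ = algebraMap C K (g (algebraMap k S r))
    rw [AlgHom.commutes, ← IsScalarTower.algebraMap_apply]
  letI := FractionRing.liftAlgebra S K
  haveI : IsScalarTower k (FractionRing S) K := inferInstance
  haveI : IsScalarTower S (FractionRing S) K := inferInstance
  haveI : Algebra.IsAlgebraic S C := inferInstance
  haveI : IsLocalization (Algebra.algebraMapSubmonoid C (nonZeroDivisors S)) K := inferInstance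
  haveI : FiniteDimensional (FractionRing S) K := .of_isLocalization S C (nonZeroDivisors S)
  exact finite_perf (P := FractionRing S) (ratfunc_perf (d := d) _)

end FieldL


section Descent

lemma pow_period (k : Type*) [Field k] [Fintype k] {F : Type*} [Field F] [Algebra k F]
    [Algebra.IsAlgebraic k F] (u : F) : ∃ s, 1 ≤ s ∧ u ^ (Fintype.card k ^ s) = u := by
  have hi : IsIntegral k u := Algebra.IsIntegral.isIntegral u
  let L := IntermediateField.adjoin k {u}
  haveI : FiniteDimensional k L := IntermediateField.adjoin.finiteDimensional hi
  haveI : Finite L := Module.finite_of_finite k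
  letI : Fintype L := Fintype.ofFinite L
  have hcard : Fintype.card L = Fintype.card k ^ Module.finrank k L :=
    Module.card_eq_pow_finrank
  refine ⟨Module.finrank k L, Module.finrank_pos, ?_⟩
  have := FiniteField.pow_card (K := L) ⟨u, IntermediateField.mem_adjoin_simple_self k _⟩
  rw [hcard] at this
  exact congrArg Subtype.val this

lemma pow_iter_period {F : Type*} [Monoid F] {u : F} {Q : ℕ} (h : u ^ Q = u) (j : ℕ) :
    u ^ (Q ^ j) = u := by
  induction j with
  | zero => simp
  | succ j ih => rw [pow_succ, pow_mul, ih, h]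

lemma pow_period_fin (k : Type*) [Field k] [Fintype k] {F : Type*} [Field F] [Algebra k F]
    [Algebra.IsAlgebraic k F] {n : ℕ} (u : Fin n → F) :
    ∃ s, 1 ≤ s ∧ ∀ i, u i ^ (Fintype.card k ^ s) = u i := by
  choose s hs1 hs using fun i => pow_period k (u i)
  refine ⟨∏ i, s i, Nat.one_le_iff_ne_zero.2 (Finset.prod_ne_zero_iff.2 fun i _ => by
    have := hs1 i; omega), fun i => ?_⟩
  obtain ⟨d, hd⟩ := Finset.dvd_prod_of_mem s (Finset.mem_univ i)
  rw [hd, pow_mul]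
  exact pow_iter_period (hs i) d

variable {Fq F : Type*} [Field Fq] [Fintype Fq] [Field F] [Algebra Fq F]
  [Algebra.IsAlgebraic Fq F] [IsAlgClosed F]
  {R : Type*} [CommRing R] [IsDomain R] [Algebra F R]

lemma exists_field {n : ℕ} (c : Fin n → R) (Z : Set F) (hZ : Z.Finite) :
    ∃ k : IntermediateField Fq F, Z ⊆ k ∧ Finite k ∧
      ∀ x : FractionRing (Algebra.adjoin k (Set.range c)),
        (∀ e, ∃ y, y ^ (Nat.card k ^ e) = x) → ∃ r : k, algebraMap k _ r = x := by
  classical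
  let 𝕂 := FractionRing R
  let k0 : IntermediateField Fq F := IntermediateField.adjoin Fq Z
  haveI : Finite Z := hZ
  haveI : FiniteDimensional Fq k0 := IntermediateField.finiteDimensional_adjoin
    fun x _ => Algebra.IsIntegral.isIntegral x
  haveI : Finite k0 := Module.finite_of_finite Fq
  letI : Fintype k0 := Fintype.ofFinite k0
  haveI : Algebra.IsAlgebraic k0 F := inferInstance
  set q := Fintype.card k0 with hq
  have hq2 : 2 ≤ q := Fintype.one_lt_card
  -- maps from the small fraction fields to the big one
  have hval : ∀ k : IntermediateField Fq F,
      Function.Injective ((Algebra.adjoin k (Set.range c)).val.toRingHom) :=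
    fun k => Subtype.val_injective
  let lam : ∀ k : IntermediateField Fq F,
      FractionRing (Algebra.adjoin k (Set.range c)) →+* 𝕂 := fun k => IsFractionRing.map (hval k)
  have hlam : ∀ (k : IntermediateField Fq F) (z : Algebra.adjoin k (Set.range c)),
      lam k (algebraMap _ _ z) = algebraMap R 𝕂 (z : R) := fun k z =>
    IsLocalization.map_eq _ z
  have hlamk : ∀ (k : IntermediateField Fq F) (u : k),
      lam k (algebraMap k _ u) = algebraMap F 𝕂 (u : F) := fun k u => by
    rw [IsScalarTower.algebraMap_apply k (Algebra.adjoin k (Set.range c)), hlam,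
      IsScalarTower.algebraMap_apply F R 𝕂]
    rfl
  haveI : Algebra.FiniteType k0 (Algebra.adjoin k0 (Set.range c)) := by
    rw [← Subalgebra.fg_iff_finiteType]
    exact Subalgebra.fg_def.2 ⟨_, Set.finite_range c, rfl⟩
  obtain ⟨M, hM1, hM⟩ := lemmaL (k := k0) (C := Algebra.adjoin k0 (Set.range c))
    (K := FractionRing (Algebra.adjoin k0 (Set.range c)))
  rw [← hq] at hM
  let S : Subfield F := (lam k0).fieldRange.comap (algebraMap F 𝕂)
  have hk0S : ∀ u : k0, (u : F) ∈ S := fun u => ⟨algebraMap k0 _ u, hlamk k0 u⟩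
  let k : IntermediateField Fq F := S.toIntermediateField
    fun x => hk0S ⟨algebraMap Fq F x, IntermediateField.algebraMap_mem k0 x⟩
  have hkmem : ∀ u : F, u ∈ k ↔ ∃ z, lam k0 z = algebraMap F 𝕂 u := fun u => Iff.rfl
  have hk0k : ∀ u : F, u ∈ k0 → u ∈ k := fun u hu => hk0S ⟨u, hu⟩
  have hF𝕂 : Function.Injective (algebraMap F 𝕂) := (algebraMap F 𝕂).injective
  -- finiteness
  have hkM : ∀ u : F, u ∈ k → u ^ (q ^ M) = u := by
    intro u hu
    obtain ⟨z, hz⟩ := (hkmem u).1 hu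
    obtain ⟨s, hs1, hs⟩ := pow_period k0 u
    have hzs : z ^ (q ^ s) = z := (lam k0).injective (by rw [map_pow, hz, ← map_pow, hs])
    have := hM z fun e => ⟨z ^ (q ^ (s * e - e)), by
      have h1 : s * e - e + e = s * e := Nat.sub_add_cancel (Nat.le_mul_of_pos_left e hs1)
      rw [← pow_mul, ← pow_add, h1, pow_mul]
      exact pow_iter_period hzs e⟩
    apply hF𝕂
    rw [map_pow, ← hz, ← map_pow, this]
  have hQM : 1 < q ^ M := Nat.one_lt_pow (by omega) (by omega)
  have hkfin : Finite k := by
    have hne : (Polynomial.X ^ (q ^ M) - Polynomial.X : Polynomial F) ≠ 0 :=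
      FiniteField.X_pow_card_sub_X_ne_zero F hQM
    have : (k : Set F) ⊆ ((Polynomial.X ^ (q ^ M) - Polynomial.X : Polynomial F).roots.toFinset :
        Set F) := by
      intro u hu
      simp only [Finset.mem_coe, Multiset.mem_toFinset]
      rw [Polynomial.mem_roots hne]
      simp [hkM u hu]
    exact (Finset.finite_toSet _).subset this
  refine ⟨k, fun z hz => hk0k z (IntermediateField.subset_adjoin Fq Z hz), hkfin, ?_⟩
  -- the fraction field of the new algebra is in the range of the old one
  have hr1 : ∀ z ∈ Algebra.adjoin k (Set.range c), algebraMap R 𝕂 z ∈ (lam k0).fieldRange := by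
    intro z hz
    induction hz using Algebra.adjoin_induction with
    | mem z hz =>
      exact ⟨_, hlam k0 ⟨z, Algebra.subset_adjoin hz⟩⟩
    | algebraMap u =>
      rw [IsScalarTower.algebraMap_apply k F R, ← IsScalarTower.algebraMap_apply F R 𝕂]
      exact u.2
    | add x y _ _ hx hy => rw [map_add]; exact add_mem hx hy
    | mul x y _ _ hx hy => rw [map_mul]; exact mul_mem hx hy
  have hr2 : ∀ x, lam k x ∈ (lam k0).fieldRange := by
    intro x
    obtain ⟨a, b, hb, rfl⟩ := IsFractionRing.div_surjective (A := Algebra.adjoin k (Set.range c)) x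
    rw [map_div₀, hlam, hlam]
    exact div_mem (hr1 _ a.2) (hr1 _ b.2)
  intro x hx
  obtain ⟨z, hz⟩ := hr2 x
  letI : Fintype k := Fintype.ofFinite k
  obtain ⟨r, hr1', hr⟩ : ∃ r, 1 ≤ r ∧ Nat.card k = q ^ r := by
    letI : Algebra k0 k := (IntermediateField.inclusion (F := k) (E := k0) hk0k).toRingHom.toAlgebra
    refine ⟨Module.finrank k0 k, Module.finrank_pos, ?_⟩
    rw [Nat.card_eq_fintype_card]
    exact Module.card_eq_pow_finrank
  have hzM := hM z fun e => by
    obtain ⟨y, hy⟩ := hx e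
    obtain ⟨w, hw⟩ := hr2 y
    refine ⟨w ^ (q ^ (r * e - e)), (lam k0).injective ?_⟩
    have h1 : r * e - e + e = r * e := Nat.sub_add_cancel (Nat.le_mul_of_pos_left e hr1')
    rw [← pow_mul, ← pow_add, h1, map_pow, hw, hz, ← hy, map_pow, hr, pow_mul]
  have hsplit : ∃ u : F, algebraMap F 𝕂 u = lam k0 z := by
    have hne : (Polynomial.X ^ (q ^ M) - Polynomial.X : Polynomial F) ≠ 0 :=
      FiniteField.X_pow_card_sub_X_ne_zero F hQM
    have hsp := IsAlgClosed.splits (Polynomial.X ^ (q ^ M) - Polynomial.X : Polynomial F)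
    have hroot : Polynomial.aeval (lam k0 z)
        (Polynomial.X ^ (q ^ M) - Polynomial.X : Polynomial F) = 0 := by
      rw [map_sub, map_pow, Polynomial.aeval_X, ← map_pow, hzM, sub_self]
    refine hsp.mem_range_of_isRoot hne ?_
    rw [Polynomial.IsRoot, Polynomial.eval_map_algebraMap]
    exact hroot
  obtain ⟨u, hu⟩ := hsplit
  refine ⟨⟨u, (hkmem u).2 ⟨z, hu.symm⟩⟩, (lam k).injective ?_⟩
  rw [hlamk, hu, hz]

end Descent


section ThmB

variable {F : Type*} [Field F] [IsAlgClosed F]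
  {R : Type*} [CommRing R] [IsDomain R] [Algebra F R]

lemma algHom_pow_succ_apply {k R : Type*} [CommSemiring k] [Semiring R] [Algebra k R]
    (ψ : R →ₐ[k] R) (j : ℕ) (z : R) : (ψ ^ (j + 1)) z = ψ ((ψ ^ j) z) := by
  rw [pow_succ']; rfl

lemma thmB_aux {k : Type*} [Field k] [Fintype k] [Algebra k F] [Algebra.IsAlgebraic k F]
    [Algebra k R] [IsScalarTower k F R] {n : ℕ} (c : Fin n → R)
    (hc : Function.Surjective (MvPolynomial.aeval c : MvPolynomial (Fin n) F →ₐ[F] R))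
    (G : Set (MvPolynomial (Fin n) F))
    (hG : RingHom.ker (MvPolynomial.aeval c : MvPolynomial (Fin n) F →ₐ[F] R) = Ideal.span G)
    (hGk : ∀ g ∈ G, ∃ g0 : MvPolynomial (Fin n) k, MvPolynomial.map (algebraMap k F) g0 = g)
    (ψ : R →ₐ[F] R) (hψ : Function.Injective ψ)
    (P : Fin n → MvPolynomial (Fin n) k)
    (hP : ∀ i, ψ (c i) = MvPolynomial.aeval c (P i))
    (PD : MvPolynomial (Fin n) k) (hD : (MvPolynomial.aeval c PD : R) ≠ 0)
    (hK : ∀ x : FractionRing (Algebra.adjoin k (Set.range c)),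
        (∀ e, ∃ y, y ^ (Fintype.card k ^ e) = x) → ∃ r : k, algebraMap k _ r = x) :
    ∃ x : R →ₐ[F] F, (∀ j, x ((ψ ^ j) (MvPolynomial.aeval c PD)) ≠ 0) ∧
      ∃ m, 1 ≤ m ∧ x.comp (ψ ^ m) = x := by
  let C := Algebra.adjoin k (Set.range c)
  have hcm : ∀ i, c i ∈ C := fun i => Algebra.subset_adjoin ⟨i, rfl⟩
  let a : Fin n → C := fun i => ⟨c i, hcm i⟩
  have hav : ∀ p : MvPolynomial (Fin n) k,
      ((MvPolynomial.aeval a p : C) : R) = MvPolynomial.aeval c p := by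
    intro p
    have : C.val.comp (MvPolynomial.aeval a) = MvPolynomial.aeval c := by
      ext i; simp [a]
    exact DFunLike.congr_fun this p
  have ha : Algebra.adjoin k (Set.range a) = ⊤ := by
    have := Algebra.adjoin_adjoin_coe_preimage (R := k) (s := Set.range c)
    rw [← this]
    congr 1
    ext x
    constructor
    · rintro ⟨i, rfl⟩
      exact ⟨i, rfl⟩
    · rintro ⟨i, hi⟩
      exact ⟨i, Subtype.ext hi⟩
  have hψC : ∀ z : C, ψ z ∈ C := by
    intro z
    have h1 : C ≤ C.comap (ψ.restrictScalars k) := by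
      apply Algebra.adjoin_le
      rintro _ ⟨i, rfl⟩
      change ψ (c i) ∈ C
      rw [hP, ← hav]
      exact Subtype.property _
    exact h1 z.2
  let φ : C →ₐ[k] C := ((ψ.restrictScalars k).comp C.val).codRestrict C hψC
  have hφv : ∀ z : C, ((φ z : C) : R) = ψ z := fun z => rfl
  have hφ : Function.Injective φ := by
    intro x y h
    have := congrArg Subtype.val h
    rw [hφv, hφv] at this
    exact Subtype.ext (hψ this)
  have hD' : MvPolynomial.aeval a PD ≠ 0 := by
    intro h
    apply hD
    rw [← hav, h]; rfl
  obtain ⟨e, x, he, hxD, hx⟩ := core (K := FractionRing C) (F := F) a ha φ hφ hK hD'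
  let p : MvPolynomial (Fin n) F →ₐ[F] R := MvPolynomial.aeval c
  let y : MvPolynomial (Fin n) F →ₐ[F] F := MvPolynomial.aeval (fun i => x (a i))
  have hyk : ∀ q : MvPolynomial (Fin n) k,
      y (MvPolynomial.map (algebraMap k F) q) = x (MvPolynomial.aeval a q) := by
    intro q
    simp only [y, MvPolynomial.aeval_map_algebraMap]
    have : x.comp (MvPolynomial.aeval a) = MvPolynomial.aeval (fun i => x (a i)) := by
      ext i; simp
    exact (DFunLike.congr_fun this q).symm
  have hpk : ∀ q : MvPolynomial (Fin n) k,
      p (MvPolynomial.map (algebraMap k F) q) = MvPolynomial.aeval a q := by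
    intro q
    rw [hav]
    simp only [p, MvPolynomial.aeval_map_algebraMap]
  have hker : ∀ q, p q = 0 → y q = 0 := by
    intro q hq
    have h1 : q ∈ Ideal.span G := by rw [← hG]; exact hq
    have h2 : Ideal.span G ≤ RingHom.ker y := by
      rw [Ideal.span_le]
      intro g hg
      obtain ⟨g0, rfl⟩ := hGk g hg
      change y _ = 0
      rw [hyk]
      have h3 : p (MvPolynomial.map (algebraMap k F) g0) = 0 := by
        have : MvPolynomial.map (algebraMap k F) g0 ∈ Ideal.span G := Ideal.subset_span hg
        rw [← hG] at this
        exact this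
      rw [hpk] at h3
      have : MvPolynomial.aeval a g0 = 0 := Subtype.ext h3
      rw [this, map_zero]
    exact h2 h1
  have hp : Function.Surjective p := hc
  let X : R →ₐ[F] F :=
    (Ideal.Quotient.liftₐ (RingHom.ker p) y (fun q hq => hker q hq)).comp
      (Ideal.quotientKerAlgEquivOfSurjective hp).symm.toAlgHom
  have hX : ∀ q, X (p q) = y q := by
    intro q
    have : (Ideal.quotientKerAlgEquivOfSurjective hp).symm (p q) =
        Ideal.Quotient.mk _ q := by
      rw [AlgEquiv.symm_apply_eq]; rfl
    change Ideal.Quotient.liftₐ (RingHom.ker p) y (fun q hq => hker q hq)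
      ((Ideal.quotientKerAlgEquivOfSurjective hp).symm (p q)) = _
    rw [this]; rfl
  have haev : ∀ z : C, ∃ q : MvPolynomial (Fin n) k, MvPolynomial.aeval a q = z := by
    intro z
    have : z ∈ Algebra.adjoin k (Set.range a) := by rw [ha]; trivial
    rw [Algebra.adjoin_range_eq_range_aeval] at this
    exact this
  have hXC : ∀ z : C, X z = x z := by
    intro z
    obtain ⟨q, rfl⟩ := haev z
    rw [← hpk, hX, hyk]
  have hXψ : ∀ (j : ℕ) (z : C), X ((ψ ^ j) z) = x z ^ ((Fintype.card k ^ e) ^ j) := by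
    intro j
    induction j with
    | zero => intro z; simp [hXC]
    | succ j ih =>
      intro z
      have : (ψ ^ (j + 1)) (z : R) = (ψ ^ j) (φ z : C) := by
        rw [pow_succ]; rfl
      rw [this, ih, hx, ← pow_mul, pow_succ']
  refine ⟨X, fun j => ?_, ?_⟩
  · rw [← hav, hXψ]
    exact pow_ne_zero _ hxD
  · obtain ⟨s, hs1, hs⟩ := pow_period_fin k (fun i => x (a i))
    refine ⟨s, hs1, ?_⟩
    have : (X.comp (ψ ^ s)).comp p = X.comp p := by
      ext i
      simp only [AlgHom.comp_apply, p, MvPolynomial.aeval_X]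
      have h1 := hXψ s (a i)
      have h2 := hXC (a i)
      simp only [a] at h1 h2
      rw [h1, h2, pow_right_comm]
      exact pow_iter_period (hs i) e
    ext z
    obtain ⟨q, rfl⟩ := hp z
    exact DFunLike.congr_fun this q

theorem thmB (Fq : Type*) [Field Fq] [Fintype Fq] [Algebra Fq F] [Algebra.IsAlgebraic Fq F]
    [Algebra.FiniteType F R] (ψ : R →ₐ[F] R) (hψ : Function.Injective ψ) {D : R} (hD : D ≠ 0) :
    ∃ x : R →ₐ[F] F, (∀ j, x ((ψ ^ j) D) ≠ 0) ∧ ∃ m, 1 ≤ m ∧ x.comp (ψ ^ m) = x := by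
  classical
  obtain ⟨n, p, hp⟩ := Algebra.FiniteType.iff_quotient_mvPolynomial''.1
    (inferInstance : Algebra.FiniteType F R)
  let c : Fin n → R := fun i => p (MvPolynomial.X i)
  have hpc : p = MvPolynomial.aeval c := by ext i; simp [c]
  rw [hpc] at hp
  obtain ⟨G, hG⟩ := (isNoetherianRing_iff_ideal_fg _).1
    (inferInstance : IsNoetherianRing (MvPolynomial (Fin n) F))
    (RingHom.ker (MvPolynomial.aeval c : MvPolynomial (Fin n) F →ₐ[F] R))
  choose P hP using fun i => hp (ψ (c i))
  obtain ⟨PD, hPD⟩ := hp D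
  let S : Finset (MvPolynomial (Fin n) F) := insert PD (G ∪ Finset.univ.image P)
  let Z : Set F := ⋃ q ∈ S, (q.coeffs : Set F)
  have hZ : Z.Finite := Set.Finite.biUnion S.finite_toSet fun q _ => q.coeffs.finite_toSet
  obtain ⟨k, hZk, hfin, hK⟩ := exists_field (Fq := Fq) c Z hZ
  letI : Fintype k := Fintype.ofFinite k
  haveI : Algebra.IsAlgebraic k F := inferInstance
  rw [Nat.card_eq_fintype_card] at hK
  have hS : ∀ q ∈ S, ∃ q0 : MvPolynomial (Fin n) k,
      MvPolynomial.map (algebraMap k F) q0 = q := by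
    intro q hq
    apply (MvPolynomial.mem_range_map_iff_coeffs_subset).2
    intro z hz
    have : z ∈ Z := Set.mem_biUnion hq hz
    exact ⟨⟨z, hZk this⟩, rfl⟩
  choose P0 hP0 using fun i => hS (P i) (by simp [S])
  obtain ⟨PD0, hPD0⟩ := hS PD (by simp [S])
  have key : ∀ q0 : MvPolynomial (Fin n) k,
      (MvPolynomial.aeval c (MvPolynomial.map (algebraMap k F) q0) : R) =
        MvPolynomial.aeval c q0 := fun q0 => MvPolynomial.aeval_map_algebraMap ..
  have hDD : D = MvPolynomial.aeval c PD0 := by rw [← key, hPD0, hPD]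
  rw [hDD] at hD ⊢
  refine thmB_aux c hp G hG.symm (fun g hg => hS g ?_) ψ hψ P0 (fun i => ?_) PD0 hD hK
  · simp only [S, Finset.mem_insert, Finset.mem_union]
    exact Or.inr (Or.inl hg)
  · rw [← key, hP0, hP]

end ThmB


section Cone

open Polynomial

section Val

variable {F : Type*} [Field F] {E : Type*} [CommRing E] [Algebra F E]
  {R : Subalgebra F E}

/-- the rational function `z` takes the value `c` at the point `x` -/
def Val (x : R →ₐ[F] F) (z : E) (c : F) : Prop :=
  ∃ r s : R, x s ≠ 0 ∧ z * s = r ∧ x r = c * x s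

lemma Val.unique {x : R →ₐ[F] F} {z : E} {c d : F} (h : Val x z c) (h' : Val x z d) : c = d := by
  obtain ⟨r, s, hs, h1, h2⟩ := h
  obtain ⟨r', s', hs', h1', h2'⟩ := h'
  have e : r * s' = r' * s := by
    apply Subtype.ext
    push_cast
    rw [← h1, ← h1']; ring
  have e2 := congrArg x e
  rw [map_mul, map_mul, h2, h2'] at e2
  have : (c - d) * (x s * x s') = 0 := by linear_combination e2
  rcases mul_eq_zero.1 this with h | h
  · exact sub_eq_zero.1 h
  · exact absurd h (mul_ne_zero hs hs')

lemma Val.add {x : R →ₐ[F] F} {z w : E} {c d : F} (h : Val x z c) (h' : Val x w d) :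
    Val x (z + w) (c + d) := by
  obtain ⟨r, s, hs, h1, h2⟩ := h
  obtain ⟨r', s', hs', h1', h2'⟩ := h'
  refine ⟨r * s' + r' * s, s * s', ?_, ?_, ?_⟩
  · rw [map_mul]; exact mul_ne_zero hs hs'
  · push_cast
    rw [← h1, ← h1']; ring
  · simp only [map_add, map_mul, h2, h2']; ring

lemma Val.mul {x : R →ₐ[F] F} {z w : E} {c d : F} (h : Val x z c) (h' : Val x w d) :
    Val x (z * w) (c * d) := by
  obtain ⟨r, s, hs, h1, h2⟩ := h
  obtain ⟨r', s', hs', h1', h2'⟩ := h'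
  refine ⟨r * r', s * s', ?_, ?_, ?_⟩
  · rw [map_mul]; exact mul_ne_zero hs hs'
  · push_cast
    rw [← h1, ← h1']; ring
  · simp only [map_mul, h2, h2']; ring

lemma Val.const (x : R →ₐ[F] F) (c : F) : Val x (algebraMap F E c) c := by
  refine ⟨algebraMap F R c, 1, ?_, ?_, ?_⟩
  · rw [map_one]; exact one_ne_zero
  · simp
  · simp

lemma Val.pow {x : R →ₐ[F] F} {z : E} {c : F} (h : Val x z c) (j : ℕ) :
    Val x (z ^ j) (c ^ j) := by
  induction j with
  | zero => simpa using Val.const x 1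
  | succ j ih => rw [pow_succ, pow_succ]; exact ih.mul h

lemma Val.comp {x : R →ₐ[F] F} {ψ : R →ₐ[F] R} {Ψ : E →ₐ[F] E} (hΨ : ∀ r : R, (ψ r : E) = Ψ r)
    {z : E} {c : F} (h : Val (x.comp ψ) z c) : Val x (Ψ z) c := by
  obtain ⟨r, s, hs, h1, h2⟩ := h
  refine ⟨ψ r, ψ s, hs, ?_, h2⟩
  rw [hΨ, hΨ, ← map_mul, h1]

lemma Val.exists_algHom {A : Type*} [CommRing A] [Algebra F A] (θ : A →ₐ[F] E) (x : R →ₐ[F] F)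
    (h : ∀ b, ∃ c, Val x (θ b) c) : ∃ y : A →ₐ[F] F, ∀ b, Val x (θ b) (y b) := by
  choose y hy using h
  have hc : ∀ c : F, y (algebraMap F A c) = c := fun c =>
    (hy _).unique (by simpa using Val.const x c)
  refine ⟨{ toFun := y, map_one' := ?_, map_mul' := ?_, map_zero' := ?_, map_add' := ?_,
            commutes' := hc }, hy⟩
  · simpa using hc 1
  · exact fun a b => (hy _).unique (by rw [map_mul]; exact (hy a).mul (hy b))
  · simpa using hc 0
  · exact fun a b => (hy _).unique (by rw [map_add]; exact (hy a).add (hy b))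

end Val

theorem thmA {F : Type*} [Field F] [IsAlgClosed F]
    (Fq : Type*) [Field Fq] [Fintype Fq] [Algebra Fq F] [Algebra.IsAlgebraic Fq F]
    {A : Type*} [CommRing A] [Algebra F A] [Algebra.FiniteType F A]
    {K : Type*} [Field K] [Algebra F K] (π : A →ₐ[F] K) (Φ : K →ₐ[F] K) {g : A}
    (hg : π g ≠ 0) (H : ∀ b, ∃ s b', Φ (π b) * π g ^ s = π b') :
    ∃ (x : ℕ → (A →ₐ[F] F)) (m : ℕ), 1 ≤ m ∧ x m = x 0 ∧ (∀ j, x j g ≠ 0) ∧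
      ∀ j b s b', Φ (π b) * π g ^ s = π b' → x (j + 1) b * x j g ^ s = x j b' := by
  classical
  obtain ⟨S, hS⟩ := (inferInstance : Algebra.FiniteType F A).out
  let T : Finset K[X] := insert X (S.image fun a => X * C (π a))
  let R : Subalgebra F K[X] := Algebra.adjoin F (T : Set K[X])
  have hXR : (X : K[X]) ∈ R := Algebra.subset_adjoin (by simp [T])
  have haR : ∀ a ∈ S, X * C (π a) ∈ R := fun a ha =>
    Algebra.subset_adjoin (by
      simp only [T, Finset.coe_insert, Finset.coe_image]
      exact Or.inr ⟨a, ha, rfl⟩)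
  let θ : A →ₐ[F] K[X] := (CAlgHom : K →ₐ[F] K[X]).comp π
  have hθ : ∀ b, θ b = C (π b) := fun b => rfl
  have hpow : ∀ b : A, ∃ N0, ∀ N, N0 ≤ N → X ^ N * C (π b) ∈ R := by
    intro b
    have hb : b ∈ Algebra.adjoin F (S : Set A) := by rw [hS]; trivial
    induction hb using Algebra.adjoin_induction with
    | mem a ha =>
      refine ⟨1, fun N hN => ?_⟩
      obtain ⟨N, rfl⟩ := Nat.exists_eq_add_of_le' hN
      rw [pow_succ, mul_assoc]
      exact R.mul_mem (R.pow_mem hXR _) (haR a ha)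
    | algebraMap r =>
      refine ⟨0, fun N _ => R.mul_mem (R.pow_mem hXR _) ?_⟩
      rw [← hθ, AlgHom.commutes]
      exact R.algebraMap_mem r
    | add a b _ _ iha ihb =>
      obtain ⟨N1, h1⟩ := iha
      obtain ⟨N2, h2⟩ := ihb
      refine ⟨max N1 N2, fun N hN => ?_⟩
      rw [map_add, C_add, mul_add]
      exact R.add_mem (h1 N (le_trans (le_max_left _ _) hN)) (h2 N (le_trans (le_max_right _ _) hN))
    | mul a b _ _ iha ihb =>
      obtain ⟨N1, h1⟩ := iha
      obtain ⟨N2, h2⟩ := ihb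
      refine ⟨N1 + N2, fun N hN => ?_⟩
      have : (X : K[X]) ^ N * C (π (a * b)) =
          (X ^ N1 * C (π a)) * (X ^ (N - N1) * C (π b)) := by
        rw [map_mul, C_mul]
        have : N = N1 + (N - N1) := by omega
        conv_lhs => rw [this, pow_add]
        ring
      rw [this]
      exact R.mul_mem (h1 _ le_rfl) (h2 _ (by omega))
  choose N0 hN0 using hpow
  choose s0 b0 hb0 using H
  let s := S.sup s0
  let b1 : A → A := fun a => b0 a * g ^ (s - s0 a)
  have hb1 : ∀ a ∈ S, Φ (π a) * π g ^ s = π (b1 a) := by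
    intro a ha
    have hle : s0 a ≤ s := Finset.le_sup ha
    simp only [b1, map_mul, map_pow, ← hb0]
    rw [mul_assoc, ← pow_add]
    congr 2
    omega
  let M := N0 (g ^ s) + S.sup (fun a => N0 (b1 a)) + 1
  let h := π (g ^ s)
  have hh : h ≠ 0 := by simpa [h] using pow_ne_zero s hg
  let Ψ : K[X] →ₐ[F] K[X] := Polynomial.eval₂AlgHom ((CAlgHom : K →ₐ[F] K[X]).comp Φ)
    (C h * X ^ M) (fun _ => Commute.all _ _)
  have hΨX : Ψ X = C h * X ^ M := by simp [Ψ]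
  have hΨC : ∀ z, Ψ (C z) = C (Φ z) := by intro z; simp [Ψ]
  have hΨR : ∀ r : R, Ψ r ∈ R := by
    intro r
    have : R ≤ R.comap Ψ := by
      apply Algebra.adjoin_le
      intro t ht
      simp only [T, Finset.coe_insert, Finset.coe_image] at ht
      rcases ht with rfl | ⟨a, ha, rfl⟩
      · change Ψ X ∈ R
        rw [hΨX, mul_comm]
        exact hN0 _ _ (by simp only [M]; omega)
      · change Ψ (X * C (π a)) ∈ R
        have : Ψ (X * C (π a)) = X ^ M * C (π (b1 a)) := by
          rw [map_mul, hΨX, hΨC, ← hb1 a ha, C_mul]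
          simp only [h, map_pow]
          ring
        rw [this]
        refine hN0 _ _ ?_
        have : N0 (b1 a) ≤ S.sup (fun a => N0 (b1 a)) := Finset.le_sup (f := fun a => N0 (b1 a)) ha
        simp only [M]; omega
    exact this r.2
  let ψ : R →ₐ[F] R := (Ψ.comp R.val).codRestrict R hΨR
  have hψ : ∀ r : R, (ψ r : K[X]) = Ψ r := fun r => rfl
  have hΨi : Function.Injective Ψ := by
    rw [injective_iff_map_eq_zero]
    intro p hp
    have e : Ψ p = (p.map (Φ : K →+* K)).comp (C h * X ^ M) := by
      rw [Polynomial.comp, Polynomial.eval₂_map]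
      rfl
    rw [e, Polynomial.comp_eq_zero_iff] at hp
    rcases hp with hp | ⟨_, hp⟩
    · exact (Polynomial.map_eq_zero _).1 hp
    · exfalso
      have := congrArg Polynomial.natDegree hp
      rw [Polynomial.natDegree_C_mul_X_pow M h hh, Polynomial.natDegree_C] at this
      simp [M] at this
  have hψi : Function.Injective ψ := by
    intro a b hab
    apply Subtype.ext
    apply hΨi
    rw [← hψ, ← hψ, hab]
  haveI : Algebra.FiniteType F R := by
    rw [← Subalgebra.fg_iff_finiteType]
    exact ⟨T, rfl⟩
  let XR : R := ⟨X, hXR⟩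
  let GR : R := ⟨X ^ N0 g * C (π g), hN0 g _ le_rfl⟩
  have hD : XR * GR ≠ 0 := by
    intro h0
    have := congrArg Subtype.val h0
    change X * (X ^ N0 g * C (π g)) = (0 : K[X]) at this
    have h1 : C (π g) ≠ 0 := by simpa using hg
    exact mul_ne_zero X_ne_zero (mul_ne_zero (pow_ne_zero _ X_ne_zero) h1) this
  obtain ⟨x, hx, m, hm, hxm⟩ := thmB Fq ψ hψi hD
  have hne : ∀ j, x ((ψ ^ j) XR) ≠ 0 ∧ x ((ψ ^ j) GR) ≠ 0 := by
    intro j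
    have := hx j
    rw [map_mul, map_mul] at this
    exact mul_ne_zero_iff.1 this
  have hex : ∀ ξ : R →ₐ[F] F, ξ XR ≠ 0 → ∃ y : A →ₐ[F] F, ∀ b, Val ξ (θ b) (y b) := by
    intro ξ hξ
    apply Val.exists_algHom
    intro b
    refine ⟨ξ ⟨X ^ N0 b * C (π b), hN0 b _ le_rfl⟩ / (ξ XR) ^ N0 b,
      ⟨X ^ N0 b * C (π b), hN0 b _ le_rfl⟩, XR ^ N0 b, ?_, ?_, ?_⟩
    · rw [map_pow]; exact pow_ne_zero _ hξ
    · rw [hθ]; push_cast; simp only [XR]; ring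
    · rw [map_pow, div_mul_cancel₀ _ (pow_ne_zero _ hξ)]
  choose y hy using fun j => hex (x.comp (ψ ^ j)) (hne j).1
  refine ⟨y, m, hm, ?_, ?_, ?_⟩
  · ext b
    apply (hy m b).unique
    rw [hxm]
    exact hy 0 b
  · intro j h0
    have h1 := hy j g
    have h2 : Val (x.comp (ψ ^ j)) (θ g)
        (x.comp (ψ ^ j) GR / (x.comp (ψ ^ j) XR) ^ N0 g) := by
      refine ⟨GR, XR ^ N0 g, ?_, ?_, ?_⟩
      · rw [map_pow]; exact pow_ne_zero _ (hne j).1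
      · rw [hθ]; push_cast; simp only [XR, GR]; ring
      · rw [map_pow]
        exact (div_mul_cancel₀ _ (pow_ne_zero _ (hne j).1)).symm
    have h3 := h1.unique h2
    rw [h0] at h3
    exact div_ne_zero (hne j).2 (pow_ne_zero _ (hne j).1) h3.symm
  · intro j b s b' hb
    have h1 := hy (j + 1) b
    have e : x.comp (ψ ^ (j + 1)) = (x.comp (ψ ^ j)).comp ψ := by
      rw [pow_succ]; rfl
    rw [e] at h1
    have h2 := (Val.comp hψ h1).mul ((hy j g).pow s)
    refine Val.unique h2 ?_
    rw [hθ, hΨC, hθ, ← C_pow, ← C_mul, hb, ← hθ]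
    exact hy j b'

end Cone


section Geometry

lemma exists_periodic_generic {T : Type*} [TopologicalSpace T] [NoetherianSpace T]
    [QuasiSober T] [T0Space T] (f : T → T) (hf : Continuous f) (hd : DenseRange f)
    {W : Set T} (hW : IsOpen W) (hne : W.Nonempty) :
    ∃ η ∈ W, ∃ r, 1 ≤ r ∧ f^[r] η = η := by
  have hfin : (genericPoints T).Finite :=
    genericPoints.finite NoetherianSpace.finite_irreducibleComponents
  have hcov : ∀ t : T, ∃ ζ ∈ genericPoints T, ζ ⤳ t := by
    intro t
    let ζ := genericPoints.ofComponent
      ⟨irreducibleComponent t, irreducibleComponent_mem_irreducibleComponents t⟩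
    refine ⟨ζ, ζ.2, ?_⟩
    have h1 : IsGenericPoint ζ.1 (irreducibleComponent t) :=
      genericPoints.isGenericPoint_ofComponent
        ⟨irreducibleComponent t, irreducibleComponent_mem_irreducibleComponents t⟩
    exact h1.specializes mem_irreducibleComponent
  have hsurj : ∀ η : genericPoints T, ∃ ζ : genericPoints T, f ζ = η := by
    intro η
    have hclosed : IsClosed (⋃ ζ ∈ genericPoints T, closure {f ζ}) :=
      hfin.isClosed_biUnion fun _ _ => isClosed_closure
    have hsub : Set.range f ⊆ ⋃ ζ ∈ genericPoints T, closure {f ζ} := by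
      rintro _ ⟨t, rfl⟩
      obtain ⟨ζ, hζ, h⟩ := hcov t
      exact Set.mem_biUnion hζ (h.map hf).mem_closure
    have huniv : (η : T) ∈ ⋃ ζ ∈ genericPoints T, closure {f ζ} := by
      have := hclosed.closure_subset_iff.2 hsub
      rw [hd.closure_range] at this
      exact this trivial
    obtain ⟨ζ, hζ, h⟩ := Set.mem_iUnion₂.1 huniv
    refine ⟨⟨ζ, hζ⟩, ?_⟩
    have hle : closure {(η : T)} ⊆ closure {f ζ} :=
      closure_minimal (Set.singleton_subset_iff.2 h) isClosed_closure
    have hmax := η.2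
    have hle2 : closure {f ζ} ⊆ closure {(η : T)} :=
      hmax.2 (isIrreducible_singleton.closure) hle
    have : closure {f ζ} = closure {(η : T)} := hle2.antisymm hle
    exact (inseparable_iff_closure_eq.2 this).eq
  choose s hs using hsurj
  haveI : Finite (genericPoints T) := hfin
  have hsi : Function.Injective s := by
    intro a b hab
    apply Subtype.ext
    rw [← hs a, ← hs b, hab]
  obtain ⟨w, hw⟩ := hne
  obtain ⟨η, hη, hηw⟩ := hcov w
  refine ⟨η, hηw.mem_open hW hw, ?_⟩
  obtain ⟨r, hr, hper⟩ := Function.mem_periodicPts.1 (hsi.mem_periodicPts (⟨η, hη⟩ : genericPoints T))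
  refine ⟨r, hr, ?_⟩
  have hit : ∀ (r : ℕ) (a : genericPoints T), f^[r] (s^[r] a : genericPoints T) = a := by
    intro r
    induction r with
    | zero => intro a; rfl
    | succ r ih =>
      intro a
      rw [Function.iterate_succ_apply, Function.iterate_succ_apply' s, hs, ih]
  have h1 := hit r ⟨η, hη⟩
  rw [hper.eq] at h1
  exact h1

lemma alg_dyn {F : Type*} [Field F] [IsAlgClosed F]
    (Fq : Type*) [Field Fq] [Fintype Fq] [Algebra Fq F] [Algebra.IsAlgebraic Fq F]
    {A B K : Type*} [CommRing A] [CommRing B] [Field K] [Algebra A B] (g : A)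
    [IsLocalization.Away g B]
    (α : F →+* A) (hα : α.FiniteType) (φ : A →+* B) (ev : B →+* K) (Φ : K →+* K)
    (hΦ : ∀ b, Φ (ev (algebraMap A B b)) = ev (φ b))
    (hαφ : ∀ c, φ (α c) = algebraMap A B (α c)) :
    ∃ (x : ℕ → (A →+* F)) (y : ℕ → (B →+* F)) (m : ℕ), 1 ≤ m ∧ x m = x 0 ∧
      (∀ j, (y j).comp (algebraMap A B) = x j) ∧ (∀ j, (y j).comp φ = x (j + 1)) ∧
      ∀ j, (x j).comp α = RingHom.id F := by
  letI : Algebra F A := α.toAlgebra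
  haveI : Algebra.FiniteType F A := hα
  letI : Algebra F K := (ev.comp ((algebraMap A B).comp α)).toAlgebra
  let π : A →ₐ[F] K := { ev.comp (algebraMap A B) with commutes' := fun c => rfl }
  have hπ : ∀ b, π b = ev (algebraMap A B b) := fun b => rfl
  have hcom : ∀ c : F, Φ (algebraMap F K c) = algebraMap F K c := by
    intro c
    change Φ (ev (algebraMap A B (α c))) = ev (algebraMap A B (α c))
    rw [hΦ, hαφ]
  let Φ' : K →ₐ[F] K := { Φ with commutes' := hcom }
  have hΦ' : ∀ b, Φ' b = Φ b := fun b => rfl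
  have hg : π g ≠ 0 := by
    rw [hπ]
    exact ((IsLocalization.Away.algebraMap_isUnit g).map ev).ne_zero
  have hloc : ∀ z : B, ∃ s b', z * algebraMap A B g ^ s = algebraMap A B b' := by
    intro z
    obtain ⟨⟨b', ⟨_, s, rfl⟩⟩, h⟩ := IsLocalization.surj (Submonoid.powers g) z
    exact ⟨s, b', by simpa using h⟩
  have key : ∀ b s b', φ b * algebraMap A B g ^ s = algebraMap A B b' →
      Φ' (π b) * π g ^ s = π b' := by
    intro b s b' h
    rw [hΦ', hπ, hΦ, hπ, hπ, ← map_pow, ← map_mul, h]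
  obtain ⟨x, m, hm, hxm, hxg, hx⟩ := thmA Fq π Φ' hg (fun b => by
    obtain ⟨s, b', h⟩ := hloc (φ b)
    exact ⟨s, b', key b s b' h⟩)
  have hu : ∀ j, IsUnit ((x j : A →+* F) g) := fun j => (hxg j).isUnit
  let y : ℕ → (B →+* F) := fun j => IsLocalization.Away.lift g (hu j)
  have hy : ∀ j b, y j (algebraMap A B b) = x j b := fun j b =>
    IsLocalization.Away.lift_eq g (hu j) b
  refine ⟨fun j => (x j : A →+* F), y, m, hm, by simp only [hxm], ?_, ?_, ?_⟩
  · intro j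
    ext b
    exact hy j b
  · intro j
    ext b
    obtain ⟨s, b', h⟩ := hloc (φ b)
    have h1 := hx j b s b' (key b s b' h)
    have h2 := congrArg (y j) h
    rw [map_mul, map_pow, hy, hy, ← h1] at h2
    exact mul_right_cancel₀ (pow_ne_zero s (hxg j)) h2
  · intro j
    ext c
    exact (x j).commutes c

lemma exists_residue_map {X Y : Scheme.{u}} (G : X ⟶ Y) (x : X) (y : Y) (h : G x = y) :
    ∃ Φ : Y.residueField y ⟶ X.residueField x, ∀ (U : Y.Opens) (hU : y ∈ U) (b : Γ(Y, U)),
      Φ (Y.evaluation U y hU b) = X.evaluation (G ⁻¹ᵁ U) x (by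
        change G x ∈ U
        rw [h]; exact hU) (G.app U b) := by
  subst h
  exact ⟨G.residueFieldMap x, fun U hU b => Scheme.evaluation_naturality_apply G x hU b⟩

lemma evaluation_map {X : Scheme.{u}} {U U' : X.Opens} (i : U' ≤ U) (x : X) (hx : x ∈ U')
    (b : Γ(X, U)) : X.evaluation U' x hx (X.presheaf.map (homOfLE i).op b) =
      X.evaluation U x (i hx) b := by
  simp only [← Scheme.germ_residue, CommRingCat.comp_apply]
  congr 1
  exact TopCat.Presheaf.germ_res_apply _ (homOfLE i) x hx b

lemma iterateHom_apply {X : Scheme.{u}} (f : X ⟶ X) (n : ℕ) (x : X) :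
    iterateHom f n x = f^[n] x := by
  induction n generalizing x with
  | zero => rfl
  | succ n ih =>
    rw [Function.iterate_succ_apply, ← ih]
    rfl

lemma iterateHom_add {X : Scheme.{u}} (f : X ⟶ X) (a b : ℕ) :
    iterateHom f (a + b) = iterateHom f a ≫ iterateHom f b := by
  induction a with
  | zero => rw [Nat.zero_add]; exact (Category.id_comp _).symm
  | succ a ih =>
    rw [Nat.succ_add]
    change f ≫ _ = (f ≫ _) ≫ _
    rw [ih, Category.assoc]

lemma iterateHom_over {X S : Scheme.{u}} (f : X ⟶ X) (sX : X ⟶ S) (hf : f ≫ sX = sX) (n : ℕ) :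
    iterateHom f n ≫ sX = sX := by
  induction n with
  | zero => exact Category.id_comp _
  | succ n ih =>
    change (f ≫ _) ≫ _ = _
    rw [Category.assoc, ih, hf]

lemma periodic_point_of_fixed {Fq F : Type u} [Field Fq] [Fintype Fq] [Field F] [Algebra Fq F]
    [Algebra.IsAlgebraic Fq F] [IsAlgClosed F]
    (X : Scheme.{u}) (sX : X ⟶ Spec (CommRingCat.of F)) [LocallyOfFiniteType sX]
    (G : X ⟶ X) (hG : G ≫ sX = sX) (η : X) (hη : G η = η) (W : X.Opens) (hW : η ∈ W) :
    ∃ (p : ℕ → (Spec (CommRingCat.of F) ⟶ X)) (m : ℕ), 1 ≤ m ∧ p m = p 0 ∧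
      (∀ j, p j ≫ G = p (j + 1)) ∧ (∀ j, p j ≫ sX = 𝟙 _) ∧ ∀ j z, p j z ∈ W := by
  obtain ⟨U, hU, hηU, hUW⟩ := exists_isAffineOpen_mem_and_subset hW
  have hη' : η ∈ G ⁻¹ᵁ U := by
    change G η ∈ U
    rw [hη]; exact hηU
  obtain ⟨g, hgU, hηg⟩ := hU.exists_basicOpen_le (V := G ⁻¹ᵁ U) ⟨η, hη'⟩ hηU
  have hgl : X.basicOpen g ≤ U := X.basicOpen_le g
  have hDa : IsAffineOpen (X.basicOpen g) := hU.basicOpen g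
  let res : Γ(X, U) ⟶ Γ(X, X.basicOpen g) := X.presheaf.map (homOfLE hgl).op
  let φ : Γ(X, U) ⟶ Γ(X, X.basicOpen g) := G.appLE U (X.basicOpen g) hgU
  have hres : Spec.map res ≫ hU.fromSpec = hDa.fromSpec := hU.map_fromSpec hDa _
  have hφ : Spec.map φ ≫ hU.fromSpec = hDa.fromSpec ≫ G := hU.SpecMap_appLE_fromSpec G hDa hgU
  let α : CommRingCat.of F ⟶ Γ(X, U) := Spec.preimage (hU.fromSpec ≫ sX)
  have hα : Spec.map α = hU.fromSpec ≫ sX := Spec.map_preimage _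
  have hαf : α.hom.FiniteType := by
    rw [← HasRingHomProperty.Spec_iff (P := @LocallyOfFiniteType), hα]
    infer_instance
  have hαφ : α ≫ φ = α ≫ res := by
    apply Spec.map_injective
    rw [Spec.map_comp, Spec.map_comp, hα, ← Category.assoc, ← Category.assoc, hφ, hres,
      Category.assoc, hG]
  obtain ⟨Φ, hΦ⟩ := exists_residue_map G η η hη
  let ev := X.evaluation (X.basicOpen g) η hηg
  have hΦ' : ∀ b, Φ (ev (res b)) = ev (φ b) := by
    intro b
    have h1 : ev (res b) = X.evaluation U η hηU b := evaluation_map hgl η hηg b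
    rw [h1, hΦ U hηU b]
    exact (evaluation_map hgU η hηg (G.app U b)).symm
  letI : Algebra Γ(X, U) Γ(X, X.basicOpen g) := res.hom.toAlgebra
  haveI : IsLocalization.Away g Γ(X, X.basicOpen g) := hU.isLocalization_basicOpen g
  obtain ⟨x, y, m, hm, hxm, hy1, hy2, hx⟩ := alg_dyn Fq g α.hom hαf φ.hom ev.hom Φ.hom hΦ'
    (fun c => by
      have := congrArg (fun t => t.hom c) hαφ
      exact this)
  let p : ℕ → (Spec (CommRingCat.of F) ⟶ X) :=
    fun j => Spec.map (CommRingCat.ofHom (x j)) ≫ hU.fromSpec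
  refine ⟨p, m, hm, ?_, ?_, ?_, ?_⟩
  · simp only [p, hxm]
  · intro j
    have e1 : CommRingCat.ofHom (x j) = res ≫ CommRingCat.ofHom (y j) := by
      ext b
      exact (DFunLike.congr_fun (hy1 j) b).symm
    have e2 : CommRingCat.ofHom (x (j + 1)) = φ ≫ CommRingCat.ofHom (y j) := by
      ext b
      exact (DFunLike.congr_fun (hy2 j) b).symm
    simp only [p]
    rw [e1, e2, Spec.map_comp, Spec.map_comp]
    simp only [Category.assoc]
    rw [hφ, ← hres]
    simp only [Category.assoc]
  · intro j
    simp only [p, Category.assoc]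
    rw [← hα, ← Spec.map_comp]
    have : α ≫ CommRingCat.ofHom (x j) = 𝟙 _ := by
      ext c
      exact DFunLike.congr_fun (hx j) c
    rw [this, Spec.map_id]
  · intro j z
    apply hUW
    have : hU.fromSpec (Spec.map (CommRingCat.ofHom (x j)) z) ∈ Set.range hU.fromSpec := ⟨_, rfl⟩
    rw [hU.range_fromSpec] at this
    simpa [p] using this

end Geometry


end PPD

/-- **Corollary 1.4.**  Let `F` be an algebraic closure of a finite field `𝔽_q`, let `X⁰` be a
scheme of finite type over `F`, and let `f : X⁰ ⟶ X⁰` be a dominant morphism.  Then the set of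
`f`-periodic points — the images of the `F`-points `x : Spec F ⟶ X⁰` with `f^m ∘ x = x` for
some `m ≥ 1` — is Zariski dense in `X⁰`. -/
theorem periodic_points_dense
    {Fq F : Type u} [Field Fq] [Fintype Fq] [Field F] [Algebra Fq F] [IsAlgClosure Fq F]
    -- `X⁰`, a scheme of finite type over `F`:
    (X : Scheme.{u}) (sX : X ⟶ Spec (CommRingCat.of F))
    [LocallyOfFiniteType sX] [QuasiCompact sX]
    -- `f : X⁰ ⟶ X⁰`, a dominant morphism over `F`:
    (f : X ⟶ X) (hf : f ≫ sX = sX) (hdom : DenseRange f.base) :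
    Dense {p : X |
      ∃ x : Spec (CommRingCat.of F) ⟶ X,
        x ≫ sX = 𝟙 (Spec (CommRingCat.of F)) ∧
        (∃ m : ℕ, 1 ≤ m ∧ x ≫ iterateHom f m = x) ∧
        x.base (IsLocalRing.closedPoint F) = p} := by
  haveI : IsAlgClosed F := IsAlgClosure.isAlgClosed Fq
  haveI : Algebra.IsAlgebraic Fq F := IsAlgClosure.isAlgebraic
  haveI : IsLocallyNoetherian X := LocallyOfFiniteType.isLocallyNoetherian sX
  haveI : CompactSpace X := QuasiCompact.compactSpace_of_compactSpace sX
  haveI : AlgebraicGeometry.IsNoetherian X := {}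
  rw [dense_iff_inter_open]
  intro W hW hne
  obtain ⟨η, hηW, r, hr, hη⟩ := PPD.exists_periodic_generic (f : X → X) f.continuous hdom hW hne
  obtain ⟨p, m, hm, hpm, hpG, hps, hpW⟩ := PPD.periodic_point_of_fixed (Fq := Fq) X sX
    (iterateHom f r) (PPD.iterateHom_over f sX hf r) η
    ((PPD.iterateHom_apply f r η).trans hη) ⟨W, hW⟩ hηW
  have hit : ∀ j, p 0 ≫ iterateHom f (r * j) = p j := by
    intro j
    induction j with
    | zero => exact Category.comp_id _
    | succ j ih => rw [Nat.mul_succ, PPD.iterateHom_add, ← Category.assoc, ih, hpG]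
  refine ⟨p 0 (IsLocalRing.closedPoint F), hpW 0 _, p 0, hps 0, ⟨r * m, ?_, ?_⟩, rfl⟩
  · exact Nat.mul_pos hr hm
  · rw [hit, hpm]
end

section
/- Let (f, f_C) be a morphism from a correspondence c̃ : C̃ → X̃ × X̃ to a correspondence c : C → X × X (both over a field k). If Z ⊆ X is a locally c-invariant closed subset, then f⁻¹(Z) ⊆ X̃ is locally c̃-invariant. -/
open AlgebraicGeometry CategoryTheory CategoryTheory.Limits TopologicalSpace Opposite

universe u

/-- A closed subset `Z ⊆ X` is `c`-invariant for a correspondence `c = (c₁, c₂) : C ⟶ X × X`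
if `c₁(c₂⁻¹(Z)) ⊆ Z` set-theoretically. -/
def CorrInvariant {C X : Scheme.{u}} (c₁ c₂ : C ⟶ X) (Z : Set X) : Prop :=
  c₁.base '' (c₂.base ⁻¹' Z) ⊆ Z

/-- `Z ∩ U ⊆ U` is `c|_U`-invariant, where `c|_U : c₁⁻¹(U) ∩ c₂⁻¹(U) → U × U` denotes the
restriction of the correspondence `c = (c₁, c₂)` to an open subset `U ⊆ X`. -/
def CorrRestrictInvariant {C X : Scheme.{u}} (c₁ c₂ : C ⟶ X) (Z U : Set X) : Prop :=
  c₁.base '' ((c₁.base ⁻¹' U ∩ c₂.base ⁻¹' U) ∩ c₂.base ⁻¹' (Z ∩ U)) ⊆ Z ∩ U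

/-- `Z` is locally `c`-invariant: every point of `Z` has an open neighbourhood `U ⊆ X` such
that `Z ∩ U ⊆ U` is `c|_U`-invariant. -/
def CorrLocallyInvariant {C X : Scheme.{u}} (c₁ c₂ : C ⟶ X) (Z : Set X) : Prop :=
  ∀ x ∈ Z, ∃ U : Set X, IsOpen U ∧ x ∈ U ∧ CorrRestrictInvariant c₁ c₂ Z U

/-- `Z ∩ U₀ ⊆ U₀` is locally `c|_{U₀}`-invariant: every point of `Z ∩ U₀` has an open
neighbourhood `U ⊆ U₀` such that `(Z ∩ U₀) ∩ U ⊆ U` is `c|_U`-invariant (the opens of the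
open subscheme `U₀` being exactly the opens of `X` contained in `U₀`). -/
def CorrLocallyInvariantOn {C X : Scheme.{u}} (c₁ c₂ : C ⟶ X) (Z U₀ : Set X) : Prop :=
  ∀ x ∈ Z ∩ U₀, ∃ U : Set X, IsOpen U ∧ U ⊆ U₀ ∧ x ∈ U ∧
    CorrRestrictInvariant c₁ c₂ (Z ∩ U₀) U

/-- `F(c, Z) := c₂⁻¹(Z) ∩ c₁⁻¹(X ∖ Z) ⊆ C`. -/
def corrF {C X : Scheme.{u}} (c₁ c₂ : C ⟶ X) (Z : Set X) : Set C :=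
  c₂.base ⁻¹' Z ∩ c₁.base ⁻¹' (Set.univ \ Z)

/-- `G(c, Z) := ⋃_S cl(c₁(S)) ∩ cl(c₂(S)) ⊆ X`, the union over the irreducible components `S`
of `F(c, Z)` (i.e. the maximal irreducible subsets of `F(c, Z)`). -/
def corrG {C X : Scheme.{u}} (c₁ c₂ : C ⟶ X) (Z : Set X) : Set X :=
  ⋃ S ∈ {S : Set C | Maximal (fun T : Set C => T ⊆ corrF c₁ c₂ Z ∧ IsIrreducible T) S},
    closure (c₁.base '' S) ∩ closure (c₂.base '' S)

/-- **Lemma 1.3.**  Let `(f, f_C)` be a morphism from a correspondence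
`c̃ : C̃ ⟶ X̃ ×_k X̃` to a correspondence `c : C ⟶ X ×_k X` (correspondences between schemes
of finite type over a field `k`).  If `Z ⊆ X` is a locally `c`-invariant closed subset, then
`f⁻¹(Z) ⊆ X̃` is locally `c̃`-invariant. -/
theorem preimage_locally_invariant
    {k : Type u} [Field k]
    -- the correspondence `c : C ⟶ X × X` over `k`:
    (X C : Scheme.{u}) (sX : X ⟶ Spec (CommRingCat.of k)) (sC : C ⟶ Spec (CommRingCat.of k))
    [LocallyOfFiniteType sX] [QuasiCompact sX] [LocallyOfFiniteType sC] [QuasiCompact sC]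
    (c : C ⟶ pullback sX sX)
    -- the correspondence `c̃ : C̃ ⟶ X̃ × X̃` over `k`:
    (Xt Ct : Scheme.{u}) (sXt : Xt ⟶ Spec (CommRingCat.of k))
    (sCt : Ct ⟶ Spec (CommRingCat.of k))
    [LocallyOfFiniteType sXt] [QuasiCompact sXt] [LocallyOfFiniteType sCt] [QuasiCompact sCt]
    (ct : Ct ⟶ pullback sXt sXt)
    -- the morphism `(f, f_C)` of correspondences, i.e. `cᵢ ∘ f_C = f ∘ c̃ᵢ` for `i = 1, 2`:
    (f : Xt ⟶ X) (fC : Ct ⟶ C)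
    (hcomm₁ : fC ≫ c ≫ pullback.fst sX sX = ct ≫ pullback.fst sXt sXt ≫ f)
    (hcomm₂ : fC ≫ c ≫ pullback.snd sX sX = ct ≫ pullback.snd sXt sXt ≫ f)
    -- a locally `c`-invariant closed subset `Z ⊆ X`:
    (Z : Set X) (hZ : IsClosed Z)
    (hloc : CorrLocallyInvariant (c ≫ pullback.fst sX sX) (c ≫ pullback.snd sX sX) Z) :
    CorrLocallyInvariant (ct ≫ pullback.fst sXt sXt) (ct ≫ pullback.snd sXt sXt)
      (f.base ⁻¹' Z) := by
  rw [← Category.assoc] at hcomm₁ hcomm₂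
  generalize hc1 : c ≫ pullback.fst sX sX = c₁ at *
  generalize hc2 : c ≫ pullback.snd sX sX = c₂ at *
  generalize hd1 : ct ≫ pullback.fst sXt sXt = d₁ at *
  generalize hd2 : ct ≫ pullback.snd sXt sXt = d₂ at *
  have e1 : fC ≫ c₁ = d₁ ≫ f := by rw [← hc1, ← hd1]; simpa using hcomm₁
  have e2 : fC ≫ c₂ = d₂ ≫ f := by rw [← hc2, ← hd2]; simpa using hcomm₂
  have p1 : ∀ y, c₁.base (fC.base y) = f.base (d₁.base y) := fun y => by
    have h := congrArg (fun g : Ct ⟶ X => g.base y) e1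
    simpa using h
  have p2 : ∀ y, c₂.base (fC.base y) = f.base (d₂.base y) := fun y => by
    have h := congrArg (fun g : Ct ⟶ X => g.base y) e2
    simpa using h
  intro x hx
  obtain ⟨U, hU, hxU, hinv⟩ := hloc (f.base x) hx
  refine ⟨f.base ⁻¹' U, hU.preimage f.continuous, hxU, ?_⟩
  rintro _ ⟨y, ⟨⟨h1, h2⟩, h3, h4⟩, rfl⟩
  have key := hinv ⟨fC.base y, ⟨⟨?_, ?_⟩, ?_, ?_⟩, rfl⟩
  · rw [p1] at key
    exact key
  · show c₁.base (fC.base y) ∈ U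
    rw [p1]; exact h1
  · show c₂.base (fC.base y) ∈ U
    rw [p2]; exact h2
  · show c₂.base (fC.base y) ∈ Z
    rw [p2]; exact h3
  · show c₂.base (fC.base y) ∈ U
    rw [p2]; exact h4
end

section
/- Let c : C → X × X be a correspondence over a field k such that c₂ is quasi-finite, and let Z ⊆ X be a closed subset. Then dim G(c, Z) ≤ dim Z − 1, where dimension is the Krull dimension of the corresponding topological subspace and dim ∅ := −∞. -/
open AlgebraicGeometry CategoryTheory CategoryTheory.Limits TopologicalSpace Opposite

universe u

/-- Passing to a proper quotient domain strictly decreases the transcendence degree. -/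
lemma corr_trdeg_lt {k R R' : Type u} [Field k] [CommRing R] [IsDomain R] [CommRing R']
    [IsDomain R'] [Algebra k R] [Algebra k R'] [Algebra.FiniteType k R]
    (f : R →ₐ[k] R') (hf : Function.Surjective f) (r : R) (hr : r ≠ 0) (hfr : f r = 0) :
    Algebra.trdeg k R' < Algebra.trdeg k R := by
  by_contra! hle
  obtain ⟨s, hs⟩ := exists_isTranscendenceBasis k R'
  choose g hg using hf
  let x : s → R := fun i => g i
  have hx' : (f ∘ x) = ((↑) : s → R') := by ext i; simp [x, hg]
  have hind : AlgebraicIndependent k (f ∘ x) := hx' ▸ hs.1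
  have hx : AlgebraicIndependent k x := hind.of_comp f
  have hb : IsTranscendenceBasis k x :=
    hx.isTranscendenceBasis_of_trdeg_le trdeg_lt_aleph0_of_finiteType
      (hle.trans hs.cardinalMk_eq_trdeg.ge)
  have halg := hb.isAlgebraic
  obtain ⟨t, ht, hdvd⟩ := (halg.isAlgebraic r).exists_nonzero_dvd (mem_nonZeroDivisors_of_ne_zero hr)
  obtain ⟨t, htm⟩ := t
  rw [Algebra.adjoin_range_eq_range_aeval] at htm
  obtain ⟨p, rfl⟩ := htm
  have h0 : f (MvPolynomial.aeval x p) = 0 := by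
    obtain ⟨q, hq⟩ := hdvd
    change MvPolynomial.aeval x p = _ at hq
    rw [hq, map_mul, hfr, zero_mul]
  apply ht
  have : p = 0 := by
    apply (algebraicIndependent_iff.mp hind)
    rw [← h0]
    exact DFunLike.congr_fun (MvPolynomial.comp_aeval x f).symm p
  apply Subtype.ext
  simp [this]

lemma corr_isAlgebraic {R S : Type u} [CommRing R] [CommRing S] [IsDomain R] [IsDomain S]
    [Algebra R S] [FaithfulSMul R S] [Algebra.QuasiFinite R S] : Algebra.IsAlgebraic R S := by
  have : FaithfulSMul R (FractionRing S) := FaithfulSMul.trans R S _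
  let := FractionRing.liftAlgebra R (FractionRing S)
  have := FractionRing.isScalarTower_liftAlgebra R (FractionRing S)
  have : Algebra.QuasiFinite R (FractionRing S) := .trans R S _
  have : Algebra.QuasiFinite (FractionRing R) (FractionRing S) := .of_restrictScalars R _ _
  have : Module.Finite (FractionRing R) (FractionRing S) := .of_quasiFinite
  have : Algebra.IsAlgebraic R (FractionRing S) :=
    (IsFractionRing.comap_isAlgebraic_iff (K := FractionRing R)).mpr inferInstance
  exact ⟨fun s => (isAlgebraic_algebraMap_iff (IsFractionRing.injective S (FractionRing S))).mp
    (this.isAlgebraic _)⟩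

lemma corr_alg {k A B : Type u} [Field k] [CommRing A] [CommRing B] [Algebra k A] [Algebra k B]
    [Algebra.FiniteType k A] (f₁ f₂ : A →ₐ[k] B) (hq : f₂.toRingHom.QuasiFinite)
    (S : Ideal B) [S.IsPrime] (h : S.comap f₁ < S.comap f₂) : False := by
  let P := S.comap f₁
  let Q := S.comap f₂
  have : P.IsPrime := Ideal.comap_isPrime f₁ S
  have : Q.IsPrime := Ideal.comap_isPrime f₂ S
  have h1 : Algebra.trdeg k (A ⧸ P) ≤ Algebra.trdeg k (B ⧸ S) :=
    trdeg_le_of_injective (Ideal.quotientMapₐ S f₁ le_rfl) Ideal.quotientMap_injective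
  let φ : A ⧸ Q →ₐ[k] B ⧸ S := Ideal.quotientMapₐ S f₂ le_rfl
  have h2 : Algebra.trdeg k (B ⧸ S) = Algebra.trdeg k (A ⧸ Q) := by
    let : Algebra A B := f₂.toRingHom.toAlgebra
    let : Algebra (A ⧸ Q) (B ⧸ S) := φ.toRingHom.toAlgebra
    have : IsScalarTower A (A ⧸ Q) (B ⧸ S) := .of_algebraMap_eq fun _ => rfl
    have : IsScalarTower k (A ⧸ Q) (B ⧸ S) := .of_algebraMap_eq fun x => (φ.commutes x).symm
    have : FaithfulSMul (A ⧸ Q) (B ⧸ S) :=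
      (faithfulSMul_iff_algebraMap_injective _ _).mpr Ideal.quotientMap_injective
    have : Algebra.QuasiFinite A B := hq
    have : Algebra.QuasiFinite A (B ⧸ S) := inferInstance
    have : Algebra.QuasiFinite (A ⧸ Q) (B ⧸ S) := .of_restrictScalars A _ _
    have := corr_isAlgebraic (R := A ⧸ Q) (S := B ⧸ S)
    rw [← trdeg_add_eq k (A ⧸ Q) (A := B ⧸ S),
      trdeg_eq_zero (R := A ⧸ Q) (A := B ⧸ S), add_zero]
  obtain ⟨r, hrQ, hrP⟩ := Set.exists_of_ssubset h
  have h3 : Algebra.trdeg k (A ⧸ Q) < Algebra.trdeg k (A ⧸ P) :=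
    corr_trdeg_lt (Ideal.Quotient.factorₐ k h.le) (Ideal.Quotient.factor_surjective h.le)
      (Ideal.Quotient.mk _ r) (fun h0 => hrP (Ideal.Quotient.eq_zero_iff_mem.mp h0))
      (Ideal.Quotient.eq_zero_iff_mem.mpr hrQ)
  exact absurd (h1.trans h2.le) (not_le.mpr h3)

lemma corr_alg' {k A B : Type u} [CommRing k] (hk : IsField k) [CommRing A] [CommRing B]
    (σ : k →+* A) (hσ : σ.FiniteType) (f₁ f₂ : A →+* B) (hσ' : f₁.comp σ = f₂.comp σ)
    (hq : f₂.QuasiFinite)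
    (S : Ideal B) [S.IsPrime] (h : S.comap f₁ < S.comap f₂) : False := by
  let := hk.toField
  let : Algebra k A := σ.toAlgebra
  let : Algebra k B := (f₁.comp σ).toAlgebra
  have : Algebra.FiniteType k A := hσ
  exact corr_alg (k := k) { f₁ with commutes' := fun _ => rfl }
    { f₂ with commutes' := fun x => (DFunLike.congr_fun hσ' x).symm } hq S h

/-- The key geometric input: a point cannot have `c₁ s` strictly specializing to `c₂ s`. -/
lemma corr_eq_of_specializes {k : Type u} [Field k]
    {X C : Scheme.{u}} (sX : X ⟶ Spec (CommRingCat.of k)) [LocallyOfFiniteType sX]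
    (c₁ c₂ : C ⟶ X) (hc : c₁ ≫ sX = c₂ ≫ sX) [LocallyQuasiFinite c₂] (s : C)
    (hs : c₁ s ⤳ c₂ s) : c₁ s = c₂ s := by
  by_contra hne
  obtain ⟨U, hU, hsU, -⟩ := exists_isAffineOpen_mem_and_subset (U := (⊤ : X.Opens)) (x := c₂ s) trivial
  have hsU1 : c₁ s ∈ U := hs.mem_open U.2 hsU
  obtain ⟨V, hV, hsV, hVU⟩ := exists_isAffineOpen_mem_and_subset
    (U := (c₁ ⁻¹ᵁ U ⊓ c₂ ⁻¹ᵁ U)) (x := s) ⟨hsU1, hsU⟩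
  have e₁ : V ≤ c₁ ⁻¹ᵁ U := fun x hx => (hVU hx).1
  have e₂ : V ≤ c₂ ⁻¹ᵁ U := fun x hx => (hVU hx).2
  have e₀ : U ≤ sX ⁻¹ᵁ ⊤ := le_top
  have hk : IsField Γ(Spec (CommRingCat.of k), ⊤) :=
    (Scheme.ΓSpecIso (CommRingCat.of k)).commRingCatIsoToRingEquiv.toMulEquiv.isField
      (Field.toIsField k)
  have hP := IsAffineOpen.comap_primeIdealOf_appLE U hU V hV e₁ hsV
  have hQ := IsAffineOpen.comap_primeIdealOf_appLE U hU V hV e₂ hsV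
  refine corr_alg' hk (sX.appLE ⊤ U e₀).hom (sX.finiteType_appLE (isAffineOpen_top _) hU e₀)
    (c₁.appLE U V e₁).hom (c₂.appLE U V e₂).hom ?_
    (LocallyQuasiFinite.quasiFinite_appLE hU hV e₂) (hV.primeIdealOf ⟨s, hsV⟩).asIdeal ?_
  · rw [← CommRingCat.hom_comp, ← CommRingCat.hom_comp, Scheme.Hom.appLE_comp_appLE,
      Scheme.Hom.appLE_comp_appLE]
    simp only [hc]
  · change ((hV.primeIdealOf ⟨s, hsV⟩).comap (c₁.appLE U V e₁).hom) <
      ((hV.primeIdealOf ⟨s, hsV⟩).comap (c₂.appLE U V e₂).hom)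
    rw [hP, hQ]
    refine lt_of_le_of_ne ?_ ?_
    · rw [PrimeSpectrum.le_iff_specializes]
      apply hU.fromSpec.isOpenEmbedding.isInducing.specializes_iff.mp
      erw [hU.fromSpec_primeIdealOf, hU.fromSpec_primeIdealOf]
      exact hs
    · intro h
      apply hne
      have := congrArg hU.fromSpec h
      erw [hU.fromSpec_primeIdealOf, hU.fromSpec_primeIdealOf] at this
      exact this

/-- Maximal irreducible subsets of a locally closed set have a generic point. -/
lemma corr_generic {T : Type*} [TopologicalSpace T] [QuasiSober T] {A O S : Set T}
    (hA : IsClosed A) (hO : IsOpen O)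
    (hS : Maximal (fun T : Set T => T ⊆ A ∩ O ∧ IsIrreducible T) S) :
    ∃ s ∈ A ∩ O, closure {s} = closure S := by
  obtain ⟨s, hs⟩ := QuasiSober.sober hS.1.2.closure isClosed_closure
  refine ⟨s, ⟨?_, ?_⟩, hs⟩
  · exact closure_minimal (hS.1.1.trans Set.inter_subset_left) hA (hs ▸ subset_closure rfl)
  · obtain ⟨t, ht⟩ := hS.1.2.1
    have : s ⤳ t := specializes_iff_mem_closure.mpr (hs ▸ subset_closure ht)
    exact this.mem_open hO (hS.1.1 ht).2

lemma corr_finite {T : Type*} [TopologicalSpace T] [NoetherianSpace T] (F : Set T) :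
    {S : Set T | Maximal (fun T : Set T => T ⊆ F ∧ IsIrreducible T) S}.Finite := by
  have : NoetherianSpace F := Topology.IsInducing.subtypeVal.noetherianSpace
  refine ((NoetherianSpace.finite_irreducibleComponents (α := F)).image
    (fun S => Subtype.val '' S)).subset ?_
  intro S hS
  have himg : Subtype.val '' ((↑) ⁻¹' S : Set F) = S := by
    rw [Subtype.image_preimage_coe, Set.inter_eq_right.mpr hS.1.1]
  refine ⟨(↑) ⁻¹' S, ⟨?_, ?_⟩, himg⟩
  · refine ⟨?_, ?_⟩
    · obtain ⟨t, ht⟩ := hS.1.2.1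
      exact ⟨⟨t, hS.1.1 ht⟩, ht⟩
    · rintro _ _ ⟨u, hu, rfl⟩ ⟨v, hv, rfl⟩ ⟨a, haS, hau⟩ ⟨b, hbS, hbv⟩
      obtain ⟨x, hxS, hx⟩ := hS.1.2.2 u v hu hv ⟨a, haS, hau⟩ ⟨b, hbS, hbv⟩
      exact ⟨⟨x, hS.1.1 hxS⟩, hxS, hx⟩
  · intro W hW hle
    have := hS.2 (y := Subtype.val '' W) ⟨by rintro _ ⟨x, -, rfl⟩; exact x.2,
      hW.image _ continuous_subtype_val.continuousOn⟩ (himg ▸ Set.image_mono hle)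
    intro w hw
    exact this ⟨w, hw, rfl⟩

lemma corr_closure_image {S T : Type*} [TopologicalSpace S] [TopologicalSpace T] {f : S → T}
    (hf : Continuous f) {s : S} {A : Set S} (h : closure {s} = closure A) :
    closure (f '' A) = closure {f s} := by
  rw [← closure_image_closure hf, ← h, closure_image_closure hf, Set.image_singleton]

lemma corr_krullDim {α β : Type*} [Preorder α] [Preorder β] (f : α → β) (hf : StrictMono f)
    (h : ∀ a, ∃ b, f a < b) : Order.krullDim α + 1 ≤ Order.krullDim β := by
  have hle := Order.krullDim_le_of_strictMono f hf
  rcases hd : Order.krullDim α with _ | _ | n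
  · exact bot_le
  · rw [hd] at hle
    exact le_trans le_top hle
  · obtain ⟨l, hl⟩ := Order.le_krullDim_iff.mp (show (n : WithBot ℕ∞) ≤ Order.krullDim α from hd.ge)
    obtain ⟨b, hb⟩ := h l.last
    have := Order.LTSeries.length_le_krullDim ((l.map f hf).snoc b (by simpa using hb))
    have h2 : (n : WithBot ℕ∞) + 1 ≤ Order.krullDim β := by simpa [hl] using this
    exact h2

/-- **Corollary 1.7(c).**  Let `c : C ⟶ X ×_k X` be a correspondence between schemes of
finite type over a field `k` such that `c₂` is quasi-finite (of finite type with finite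
fibres), and let `Z ⊆ X` be a closed subset.  Then `dim G(c, Z) ≤ dim Z − 1`, i.e.
`dim G(c, Z) + 1 ≤ dim Z` in `WithBot ℕ∞` (so that `dim ∅ = ⊥` plays the role of `−∞`). -/
theorem corrG_dim_lt
    {k : Type u} [Field k]
    (X C : Scheme.{u}) (sX : X ⟶ Spec (CommRingCat.of k)) (sC : C ⟶ Spec (CommRingCat.of k))
    [LocallyOfFiniteType sX] [QuasiCompact sX] [LocallyOfFiniteType sC] [QuasiCompact sC]
    (c : C ⟶ pullback sX sX)
    -- `c₂` is quasi-finite: of finite type with finite fibres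
    (hqf₁ : LocallyOfFiniteType (c ≫ pullback.snd sX sX))
    (hqf₂ : QuasiCompact (c ≫ pullback.snd sX sX))
    (hfib : ∀ x : X, ((c ≫ pullback.snd sX sX).base ⁻¹' {x}).Finite)
    (Z : Set X) (hZ : IsClosed Z) :
    topologicalKrullDim
        ↥(corrG (c ≫ pullback.fst sX sX) (c ≫ pullback.snd sX sX) Z) + 1 ≤
      topologicalKrullDim ↥Z := by
  have hc : (c ≫ pullback.fst sX sX) ≫ sX = (c ≫ pullback.snd sX sX) ≫ sX := by
    simp [pullback.condition]
  generalize c ≫ pullback.fst sX sX = c₁ at *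
  generalize c ≫ pullback.snd sX sX = c₂ at *
  have : LocallyQuasiFinite c₂ := .of_finite_preimage_singleton c₂ hfib
  have : IsLocallyNoetherian C := LocallyOfFiniteType.isLocallyNoetherian sC
  have : CompactSpace C := QuasiCompact.compactSpace_of_compactSpace sC
  have : IsNoetherian C := {}
  -- the data of one component
  have key : ∀ S : Set C, Maximal (fun T : Set C => T ⊆ corrF c₁ c₂ Z ∧ IsIrreducible T) S →
      ∃ z ∈ Z, closure (c₂.base '' S) = closure {z} ∧ z ∉ closure (c₁.base '' S) := by
    intro S hS
    obtain ⟨s, ⟨hs2, hs1⟩, hcl⟩ := corr_generic (A := c₂.base ⁻¹' Z)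
      (O := c₁.base ⁻¹' (Set.univ \ Z)) (hZ.preimage c₂.continuous)
      ((by simpa [Set.sdiff_eq] using hZ.isOpen_compl : IsOpen (Set.univ \ Z)).preimage c₁.continuous)
      hS
    refine ⟨c₂ s, hs2, corr_closure_image c₂.continuous hcl, ?_⟩
    rw [corr_closure_image c₁.continuous hcl]
    intro hmem
    have := corr_eq_of_specializes sX c₁ c₂ hc s (specializes_iff_mem_closure.mpr hmem)
    apply hs1.2
    rw [this]
    exact hs2
  have hfin := corr_finite (corrF c₁ c₂ Z)
  have hGZ : corrG c₁ c₂ Z ⊆ Z := by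
    intro x hx
    simp only [corrG, Set.mem_iUnion] at hx
    obtain ⟨S, hS, -, hx2⟩ := hx
    refine closure_minimal ?_ hZ hx2
    rintro _ ⟨y, hy, rfl⟩
    exact (hS.1.1 hy).1
  have hGcl : IsClosed (corrG c₁ c₂ Z) :=
    hfin.isClosed_biUnion fun _ _ => isClosed_closure.inter isClosed_closure
  -- irreducible closed subsets of `G` lie strictly below an irreducible closed subset of `Z`
  let ι : corrG c₁ c₂ Z → Z := Set.inclusion hGZ
  have hι : Topology.IsInducing ι := (Topology.IsEmbedding.inclusion hGZ).isInducing
  have hstep : ∀ Y : IrreducibleCloseds (corrG c₁ c₂ Z), ∃ W : IrreducibleCloseds Z,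
      IrreducibleCloseds.map ι hι.continuous Y < W := by
    intro Y
    have hY : IsIrreducible (Subtype.val '' (Y : Set (corrG c₁ c₂ Z))) :=
      Y.isIrreducible.image _ continuous_subtype_val.continuousOn
    classical
    obtain ⟨D, hD, hYD⟩ := isIrreducible_iff_sUnion_isClosed.mp hY
      (hfin.toFinset.image fun S => closure (c₁.base '' S) ∩ closure (c₂.base '' S))
      (by
        intro D hD
        obtain ⟨S, -, rfl⟩ := Finset.mem_image.mp hD
        exact isClosed_closure.inter isClosed_closure)
      (by
        rintro _ ⟨y, -, rfl⟩
        have := y.2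
        simp only [corrG, Set.mem_iUnion] at this
        obtain ⟨S, hS, h⟩ := this
        exact ⟨_, Finset.mem_coe.mpr (Finset.mem_image_of_mem _ (hfin.mem_toFinset.mpr hS)), h⟩)
    obtain ⟨S, hS, rfl⟩ := Finset.mem_image.mp hD
    obtain ⟨z, hzZ, hz2, hz1⟩ := key S (hfin.mem_toFinset.mp hS)
    let W : IrreducibleCloseds Z := ⟨closure {⟨z, hzZ⟩}, isIrreducible_singleton.closure, isClosed_closure⟩
    -- the image of `Y` in `Z`
    have hsub : closure (ι '' (Y : Set (corrG c₁ c₂ Z))) ⊆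
        Subtype.val ⁻¹' (closure (c₁.base '' S) ∩ closure (c₂.base '' S)) := by
      refine closure_minimal ?_
        ((isClosed_closure.inter isClosed_closure).preimage continuous_subtype_val)
      rintro _ ⟨y, hy, rfl⟩
      exact hYD ⟨y, hy, rfl⟩
    refine ⟨W, lt_of_le_not_ge ?_ ?_⟩
    · intro x hx
      have := (hsub hx).2
      rw [hz2] at this
      change x ∈ closure {(⟨z, hzZ⟩ : Z)}
      rw [closure_subtype, Set.image_singleton]
      exact this
    · intro hle
      exact hz1 (hsub (hle (subset_closure rfl : (⟨z, hzZ⟩ : Z) ∈ closure {(⟨z, hzZ⟩ : Z)}))).1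
  exact corr_krullDim _ (IrreducibleCloseds.map_strictMono_of_isInducing hι) hstep
end
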